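/- arXiv:2005.09505 — 2 statements merged into one kernel-verified Lean document; each statement's English description precedes it below -/
import Mathlib

section
/- Let Ω ⊆ ℂⁿ be a bounded B-regular domain and let φ ≥ 0 be a plurisuperharmonic function on Ω with φ* = φ_* on the closure of Ω. Assume ψ: [0, +∞) → [0, +∞) is a continuous, concave, strictly increasing bijection (extended to +∞ by ψ(+∞) = +∞) such that ψ∘φ is tame and such that the Perron–Bremermann envelope P(ψ∘φ) locally depends on at most n−1 of the complex coordinates (each point of Ω has a neighbourhood on which P(ψ∘φ) is a function of at most n−1 of the coordinates z₁, …, z_n). Then ψ⁻¹∘P(ψ∘φ) is a maximal plurisubharmonic function on Ω, continuous outside a pluripolar set, with lim_{Ω ∋ ζ → z₀} ψ⁻¹(P(ψ∘φ)(ζ)) = φ(z₀) for every z₀ ∈ ∂Ω, i.e. it solves the generalized Dirichlet problem with boundary data φ. -/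
open Complex Polynomial Filter Set Topology

noncomputable section

/-- `u` is plurisubharmonic on `Ω ⊆ ℂⁿ`: it is upper semicontinuous on `Ω`, takes values in
`[-∞, ∞)`, is not identically `-∞`, and on every closed disc of every complex line contained
in `Ω` it satisfies the maximum principle against real parts of complex polynomials
(an equivalent formulation of subharmonicity of the restriction to every complex line). -/
def IsPSH {n : ℕ} (Ω : Set (Fin n → ℂ)) (u : (Fin n → ℂ) → EReal) : Prop :=
  UpperSemicontinuousOn u Ω ∧
  (∀ z ∈ Ω, u z ≠ ⊤) ∧
  (∃ z ∈ Ω, u z ≠ ⊥) ∧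
  ∀ z ∈ Ω, ∀ w : Fin n → ℂ, ∀ r : ℝ, 0 < r →
    (∀ ζ : ℂ, ‖ζ‖ ≤ r → z + ζ • w ∈ Ω) →
    ∀ p : Polynomial ℂ,
      (∀ ζ : ℂ, ‖ζ‖ = r → u (z + ζ • w) ≤ (((p.eval ζ).re : ℝ) : EReal)) →
      ∀ ζ : ℂ, ‖ζ‖ ≤ r → u (z + ζ • w) ≤ (((p.eval ζ).re : ℝ) : EReal)

/-- `v` is plurisuperharmonic on `Ω` iff `-v` is plurisubharmonic on `Ω`. -/
def IsPSupH {n : ℕ} (Ω : Set (Fin n → ℂ)) (v : (Fin n → ℂ) → EReal) : Prop :=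
  IsPSH Ω (fun z => -(v z))

/-- `f` belongs to the class `ℳ`: `f : Ω → [0, +∞]` admits a plurisuperharmonic
majorant on `Ω`. -/
def MemM {n : ℕ} (Ω : Set (Fin n → ℂ)) (f : (Fin n → ℂ) → EReal) : Prop :=
  (∀ z ∈ Ω, 0 ≤ f z) ∧ ∃ v, IsPSupH Ω v ∧ ∀ z ∈ Ω, f z ≤ v z

/-- The reduced function `R_λ f`: the pointwise infimum of all plurisuperharmonic
majorants of `(f - λ)⁺ = max {f - λ, 0}` on `Ω`. -/
def Rop {n : ℕ} (Ω : Set (Fin n → ℂ)) (f : (Fin n → ℂ) → EReal) (lam : ℝ)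
    (z : Fin n → ℂ) : EReal :=
  sInf { y | ∃ v, IsPSupH Ω v ∧ (∀ ζ ∈ Ω, max (f ζ - (lam : EReal)) 0 ≤ v ζ) ∧ y = v z }

/-- Lower semicontinuous regularization of `g` relative to the set `A`:
`g_*(z) = liminf_{A ∋ ζ → z} g(ζ)`. -/
def lscReg {n : ℕ} (A : Set (Fin n → ℂ)) (g : (Fin n → ℂ) → EReal)
    (z : Fin n → ℂ) : EReal :=
  liminf g (nhdsWithin z A)

/-- Upper semicontinuous regularization of `g` relative to the set `A`:
`g*(z) = limsup_{A ∋ ζ → z} g(ζ)`. -/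
def uscReg {n : ℕ} (A : Set (Fin n → ℂ)) (g : (Fin n → ℂ) → EReal)
    (z : Fin n → ℂ) : EReal :=
  limsup g (nhdsWithin z A)

/-- `S_λ f`: the lower semicontinuous regularization of `R_λ f` on `Ω`. -/
def Slam {n : ℕ} (Ω : Set (Fin n → ℂ)) (f : (Fin n → ℂ) → EReal) (lam : ℝ) :
    (Fin n → ℂ) → EReal :=
  lscReg Ω (Rop Ω f lam)

/-- The operator `S`: the lower semicontinuous regularization of
`lim_{λ → ∞} S_λ f`; since `λ ↦ S_λ f` is decreasing on `λ ≥ 0`, this limit is the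
infimum over `λ ≥ 0`. -/
def Sop {n : ℕ} (Ω : Set (Fin n → ℂ)) (f : (Fin n → ℂ) → EReal) :
    (Fin n → ℂ) → EReal :=
  lscReg Ω (fun z => ⨅ (lam : ℝ) (_ : 0 ≤ lam), Slam Ω f lam z)

/-- `f` is tame on `Ω` if `S f ≡ 0`. -/
def Tame {n : ℕ} (Ω : Set (Fin n → ℂ)) (f : (Fin n → ℂ) → EReal) : Prop :=
  ∀ z ∈ Ω, Sop Ω f z = 0

/-- `E` is a pluripolar subset of `Ω`: `E ⊆ {w = -∞}` for some plurisubharmonic `w` on `Ω`. -/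
def Pluripolar {n : ℕ} (Ω : Set (Fin n → ℂ)) (E : Set (Fin n → ℂ)) : Prop :=
  E ⊆ Ω ∧ ∃ w, IsPSH Ω w ∧ ∀ z ∈ E, w z = ⊥

/-- `Ω` is B-regular: every continuous real-valued function on `∂Ω` is the boundary value
of a function plurisubharmonic on `Ω` and continuous on `cl(Ω)`. -/
def BRegular {n : ℕ} (Ω : Set (Fin n → ℂ)) : Prop :=
  ∀ f : (Fin n → ℂ) → ℝ, ContinuousOn f (frontier Ω) →
    ∃ u : (Fin n → ℂ) → ℝ, IsPSH Ω (fun z => ((u z : ℝ) : EReal)) ∧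
      ContinuousOn u (closure Ω) ∧ ∀ z ∈ frontier Ω, u z = f z

/-- A plurisubharmonic `u` on `Ω` is maximal: for every open `Ω'` compactly contained in
`Ω` and every plurisubharmonic `v` on `Ω` with `v ≤ u` on `Ω ∖ Ω'`, one has `v ≤ u` on `Ω`. -/
def MaximalPSH {n : ℕ} (Ω : Set (Fin n → ℂ)) (u : (Fin n → ℂ) → EReal) : Prop :=
  IsPSH Ω u ∧
  ∀ Ω' : Set (Fin n → ℂ), IsOpen Ω' → Bornology.IsBounded Ω' → closure Ω' ⊆ Ω →
    ∀ v, IsPSH Ω v → (∀ z ∈ Ω \ Ω', v z ≤ u z) → ∀ z ∈ Ω, v z ≤ u z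

/-- The Perron–Bremermann envelope of the boundary data `φ`:
`Pφ(z) = sup { u(z) : u plurisubharmonic on Ω, u* ≤ φ_* on cl(Ω) }`. -/
def Perron {n : ℕ} (Ω : Set (Fin n → ℂ)) (φ : (Fin n → ℂ) → EReal)
    (z : Fin n → ℂ) : EReal :=
  sSup { y | ∃ u, IsPSH Ω u ∧ (∀ ξ ∈ closure Ω, uscReg Ω u ξ ≤ lscReg Ω φ ξ) ∧ y = u z }

/-! ### Real parts of polynomials on the unit circle -/

/-- The unit circle, parametrised additively. -/
abbrev UnitCirc := AddCircle (2 * Real.pi)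

instance factTwoPiPos : Fact (0 < 2 * Real.pi) := ⟨Real.two_pi_pos⟩

/-- The point of the complex unit circle with argument `x`. -/
def circ (x : UnitCirc) : ℂ := (AddCircle.toCircle x : ℂ)

lemma norm_circ (x : UnitCirc) : ‖circ x‖ = 1 := Circle.norm_coe _

lemma continuous_circ : Continuous circ :=
  continuous_subtype_val.comp AddCircle.continuous_toCircle

lemma exists_circ_eq {ζ : ℂ} (h : ‖ζ‖ = 1) : ∃ x, circ x = ζ := by
  obtain ⟨x, hx⟩ := (AddCircle.homeomorphCircle (T := 2 * Real.pi) (by positivity)).surjective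
    ⟨ζ, by simpa [Submonoid.unitSphere] using h⟩
  refine ⟨x, ?_⟩
  rw [AddCircle.homeomorphCircle_apply] at hx
  rw [circ, hx]

lemma toAddCircle_apply_eq_eval (p : ℂ[X]) (x : UnitCirc) :
    p.toAddCircle x = p.eval (circ x) := by
  induction p using Polynomial.induction_on' with
  | add p q hp hq => simp [hp, hq]
  | monomial m a =>
    rw [Polynomial.toAddCircle_monomial_eq_smul_fourier]
    simp [circ, AddCircle.toCircle_nsmul]

lemma continuous_eval_circ_re (p : ℂ[X]) : Continuous fun x => (p.eval (circ x)).re :=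
  Complex.continuous_re.comp (p.continuous.comp continuous_circ)

lemma integral_eval_circ_re (p : ℂ[X]) :
    ∫ x, (p.eval (circ x)).re ∂(AddCircle.haarAddCircle (T := 2 * Real.pi)) =
      (p.eval 0).re := by
  have h := Polynomial.fourierCoeff_toAddCircle_natCast p 0
  rw [fourierCoeff] at h
  simp only [Nat.cast_zero, neg_zero, fourier_zero, one_smul, toAddCircle_apply_eq_eval] at h
  rw [← Polynomial.coeff_zero_eq_eval_zero, ← h]
  have hi := Polynomial.toAddCircle.integrable p
  simp only [funext (toAddCircle_apply_eq_eval p)] at hi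
  exact integral_re hi

lemma integrable_eval_circ_re (p : ℂ[X]) : MeasureTheory.Integrable
    (fun x => (p.eval (circ x)).re) (AddCircle.haarAddCircle (T := 2 * Real.pi)) := by
  simpa using (continuous_eval_circ_re p).continuousOn.integrableOn_compact
    (μ := AddCircle.haarAddCircle) isCompact_univ

/-- The mean value property makes `p ↦ Re p(0)` monotone in the values on the circle. -/
lemma eval_zero_re_mono (p q : ℂ[X]) (c : ℝ)
    (h : ∀ ζ : ℂ, ‖ζ‖ = 1 → (p.eval ζ).re ≤ (q.eval ζ).re + c) :
    (p.eval 0).re ≤ (q.eval 0).re + c := by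
  have : ∀ x, (p.eval (circ x)).re ≤ ((q + C (c : ℂ)).eval (circ x)).re := fun x => by
    simpa using h _ (norm_circ x)
  have h2 := MeasureTheory.integral_mono (integrable_eval_circ_re p)
    (integrable_eval_circ_re (q + C (c : ℂ))) this
  simp only [integral_eval_circ_re] at h2
  simpa using h2

lemma exists_poly_re_eq (f : C(UnitCirc, ℂ)) (hf : f ∈ Submodule.span ℂ (range (@fourier
    (2 * Real.pi)))) : ∀ c : ℂ, ∃ p : ℂ[X], ∀ x, (p.eval (circ x)).re = (c * f x).re := by
  induction hf using Submodule.span_induction with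
  | mem f hf =>
    obtain ⟨k, rfl⟩ := hf
    intro c
    obtain ⟨m, rfl | rfl⟩ := k.eq_nat_or_neg
    · exact ⟨C c * X ^ m, fun x => by simp [circ, AddCircle.toCircle_nsmul]⟩
    · refine ⟨C (starRingEnd ℂ c) * X ^ m, fun x => ?_⟩
      rw [fourier_neg, ← Complex.conj_re]
      simp [circ, AddCircle.toCircle_nsmul]
  | zero => exact fun c => ⟨0, fun x => by simp⟩
  | add f g _ _ hf hg =>
    intro c
    obtain ⟨p, hp⟩ := hf c
    obtain ⟨q, hq⟩ := hg c
    exact ⟨p + q, fun x => by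
      simp only [eval_add, add_re, hp, hq, ContinuousMap.add_apply, mul_add]⟩
  | smul a f _ hf =>
    intro c
    obtain ⟨p, hp⟩ := hf (c * a)
    exact ⟨p, fun x => by rw [hp]; simp [mul_assoc]⟩

/-- Continuous functions on the circle are uniform limits of real parts of polynomials. -/
lemma exists_poly_approx (f : C(UnitCirc, ℝ)) {ε : ℝ} (hε : 0 < ε) :
    ∃ p : ℂ[X], ∀ x, |(p.eval (circ x)).re - f x| < ε := by
  let F : C(UnitCirc, ℂ) := ⟨fun x => (f x : ℂ), by fun_prop⟩
  have hF : F ∈ closure (Submodule.span ℂ (range (@fourier (2 * Real.pi))) :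
      Set C(UnitCirc, ℂ)) := by
    have h := span_fourier_closure_eq_top (T := 2 * Real.pi)
    have h2 : F ∈ (Submodule.span ℂ (range (@fourier (2 * Real.pi)))).topologicalClosure := by
      rw [h]; trivial
    exact h2
  obtain ⟨G, hG, hd⟩ := Metric.mem_closure_iff.1 hF ε hε
  obtain ⟨p, hp⟩ := exists_poly_re_eq G hG 1
  refine ⟨p, fun x => ?_⟩
  have h1 : ‖G x - F x‖ < ε := by
    rw [← dist_eq_norm, dist_comm]
    exact (ContinuousMap.dist_apply_le_dist x).trans_lt hd
  have h2 := (Complex.abs_re_le_norm (G x - F x)).trans_lt h1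
  rw [hp]
  simpa [F] using h2

lemma exists_real_add_lt {a b : EReal} {c : ℝ} (ha : a ≠ ⊤) (hb : b ≠ ⊤) (h : a + b < c) :
    ∃ s t : ℝ, a < s ∧ b < t ∧ s + t < c := by
  induction a with
  | top => exact absurd rfl ha
  | bot =>
    obtain ⟨t, ht, -⟩ := EReal.lt_iff_exists_real_btwn.1 (lt_top_iff_ne_top.2 hb)
    exact ⟨c - t - 1, t, EReal.bot_lt_coe _, ht, by linarith⟩
  | coe a =>
    induction b with
    | top => exact absurd rfl hb
    | bot => exact ⟨a + 1, c - a - 2, by exact_mod_cast lt_add_one a, EReal.bot_lt_coe _,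
        by linarith⟩
    | coe b =>
      have h : a + b < c := by exact_mod_cast h
      exact ⟨a + (c - (a + b)) / 3, b + (c - (a + b)) / 3, EReal.coe_lt_coe_iff.2 (by linarith),
        EReal.coe_lt_coe_iff.2 (by linarith), by linarith⟩

lemma exists_continuous_pair (a b : UnitCirc → EReal) (ha : UpperSemicontinuous a)
    (hb : UpperSemicontinuous b) (ha' : ∀ x, a x ≠ ⊤) (hb' : ∀ x, b x ≠ ⊤)
    (h : C(UnitCirc, ℝ)) (hab : ∀ x, a x + b x < h x) :
    ∃ g : C(UnitCirc, ℝ × ℝ), ∀ x, a x < (g x).1 ∧ b x < (g x).2 ∧ (g x).1 + (g x).2 < h x := by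
  refine exists_continuous_forall_mem_convex_of_local_const
    (t := fun x => {y : ℝ × ℝ | a x < y.1 ∧ b x < y.2 ∧ y.1 + y.2 < h x}) ?_ ?_
  · intro x
    have h1 : ∀ c : EReal, Convex ℝ {t : ℝ | c < t} := fun c =>
      (Set.OrdConnected.mk fun s hs t _ r hr => lt_of_lt_of_le hs
        (EReal.coe_le_coe_iff.2 hr.1)).convex
    have e : {y : ℝ × ℝ | a x < y.1 ∧ b x < y.2 ∧ y.1 + y.2 < h x} =
        ({t : ℝ | a x < t} ×ˢ {t : ℝ | b x < t}) ∩
          {y : ℝ × ℝ | (LinearMap.fst ℝ ℝ ℝ + LinearMap.snd ℝ ℝ ℝ) y < h x} := by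
      ext y; simp [and_assoc]
    rw [e]
    exact ((h1 _).prod (h1 _)).inter (convex_halfSpace_lt (LinearMap.isLinear _) _)
  · intro x
    obtain ⟨s, t, hs, ht, hst⟩ := exists_real_add_lt (ha' x) (hb' x) (hab x)
    have hc : ∀ᶠ y in 𝓝 x, s + t < h y := h.continuous.continuousAt.eventually_const_lt hst
    exact ⟨(s, t), by filter_upwards [ha x s hs, hb x t ht, hc] with y h1 h2 h3 using ⟨h1, h2, h3⟩⟩

/-- A sum of upper semicontinuous functions majorised by `Re p` can be split along the
summands, up to a small error. -/
lemma exists_poly_pair (a b : UnitCirc → EReal) (ha : UpperSemicontinuous a)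
    (hb : UpperSemicontinuous b) (ha' : ∀ x, a x ≠ ⊤) (hb' : ∀ x, b x ≠ ⊤)
    (p : ℂ[X]) (hab : ∀ x, a x + b x ≤ ((p.eval (circ x)).re : ℝ)) {ε : ℝ} (hε : 0 < ε) :
    ∃ q₁ q₂ : ℂ[X], (∀ x, a x ≤ ((q₁.eval (circ x)).re : ℝ)) ∧
      (∀ x, b x ≤ ((q₂.eval (circ x)).re : ℝ)) ∧
      (q₁.eval 0).re + (q₂.eval 0).re ≤ (p.eval 0).re + ε := by
  let h : C(UnitCirc, ℝ) := ⟨fun x => (p.eval (circ x)).re + ε / 5,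
    (continuous_eval_circ_re p).add continuous_const⟩
  obtain ⟨g, hg⟩ := exists_continuous_pair a b ha hb ha' hb' h fun x =>
    (hab x).trans_lt (EReal.coe_lt_coe_iff.2 (by simp [h, hε]))
  obtain ⟨p₁, hp₁⟩ := exists_poly_approx
    ⟨fun x => (g x).1, continuous_fst.comp g.continuous⟩ (show 0 < ε / 5 by positivity)
  obtain ⟨p₂, hp₂⟩ := exists_poly_approx
    ⟨fun x => (g x).2, continuous_snd.comp g.continuous⟩ (show 0 < ε / 5 by positivity)
  simp only [ContinuousMap.coe_mk, abs_lt] at hp₁ hp₂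
  refine ⟨p₁ + C ((ε / 5 : ℝ) : ℂ), p₂ + C ((ε / 5 : ℝ) : ℂ), fun x => ?_, fun x => ?_, ?_⟩
  · refine (hg x).1.le.trans (EReal.coe_le_coe_iff.2 ?_)
    have := (hp₁ x).1
    simp only [eval_add, eval_C, add_re, ofReal_re]
    linarith
  · refine (hg x).2.1.le.trans (EReal.coe_le_coe_iff.2 ?_)
    have := (hp₂ x).1
    simp only [eval_add, eval_C, add_re, ofReal_re]
    linarith
  · have := eval_zero_re_mono (p₁ + p₂) p (3 * (ε / 5)) fun ζ hζ => by
      obtain ⟨x, rfl⟩ := exists_circ_eq hζ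
      have h1 := (hp₁ x).2
      have h2 := (hp₂ x).2
      have h3 := (hg x).2.2
      simp only [ContinuousMap.coe_mk, h] at h3
      simp only [eval_add, add_re]
      linarith
    simp only [eval_add, eval_C, add_re, ofReal_re] at this ⊢
    linarith

open MeasureTheory in
/-- A lower semicontinuous function on the circle has mean at most `m` as soon as `Re p(0) ≤ m`
for every polynomial `p` whose real part it majorises. -/
lemma lintegral_circ_le (v : UnitCirc → ENNReal) (hv : LowerSemicontinuous v) (m : ENNReal)
    (h : ∀ p : ℂ[X], (∀ x, (((p.eval (circ x)).re : ℝ) : EReal) ≤ v x) →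
      (((p.eval 0).re : ℝ) : EReal) ≤ m) :
    ∫⁻ x, v x ∂(AddCircle.haarAddCircle (T := 2 * Real.pi)) ≤ m := by
  by_cases hm : m = ⊤
  · simp [hm]
  lift m to NNReal using hm
  rw [lintegral_eq_nnreal]
  refine iSup₂_le fun f hf => ?_
  have hfin : ∫⁻ x, (f x : ENNReal) ∂(AddCircle.haarAddCircle (T := 2 * Real.pi)) ≠ ⊤ := by
    obtain ⟨C, hC⟩ := f.exists_forall_le
    refine ne_top_of_le_ne_top (b := ∫⁻ x, (C : ENNReal) ∂(AddCircle.haarAddCircle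
      (T := 2 * Real.pi))) (by simp) (lintegral_mono fun x => ENNReal.coe_le_coe.2 (hC x))
  rw [← SimpleFunc.lintegral_eq_lintegral]
  simp only [SimpleFunc.map_apply]
  refine ENNReal.le_of_forall_pos_le_add fun ε hε _ => ?_
  set d : NNReal := ε / 8 with hd
  have hd0 : 0 < d := by positivity
  have hd1 : (0 : ℝ) < d := hd0
  obtain ⟨u, huf, hu, h_integ⟩ := f.exists_upperSemicontinuous_le_lintegral_le hfin
    (ε := (d : ENNReal)) (by exact_mod_cast hd0.ne')
  obtain ⟨g, hg⟩ := exists_continuous_forall_mem_convex_of_local_const (X := UnitCirc)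
    (t := fun x => {y : ℝ | (u x : ℝ) - d < y ∧ (y : EReal) < ((v x + d : ENNReal) : EReal)})
    (fun x => (Set.OrdConnected.mk fun s (hs : _ ∧ _) t (ht : _ ∧ _) r hr =>
      show _ ∧ _ from ⟨hs.1.trans_le hr.1, (EReal.coe_le_coe_iff.2 hr.2).trans_lt ht.2⟩).convex)
    (fun x => by
      refine ⟨u x, ?_⟩
      have h1 : ∀ᶠ y in 𝓝 x, u y < u x + d := hu x _ (by simpa using hd0)
      have h2 : ∀ᶠ y in 𝓝 x, (u x : ENNReal) < v y + d := by
        rcases eq_or_ne (u x) 0 with h0 | h0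
        · refine Eventually.of_forall fun y => ?_
          rw [h0]
          simp [hd0]
        · have : ((u x - d : NNReal) : ENNReal) < v x :=
            lt_of_lt_of_le (ENNReal.coe_lt_coe.2 (tsub_lt_self (pos_iff_ne_zero.2 h0) hd0))
              ((ENNReal.coe_le_coe.2 (huf x)).trans (hf x))
          filter_upwards [hv x _ this] with y hy
          calc (u x : ENNReal) ≤ ((u x - d : NNReal) : ENNReal) + d := by
                exact_mod_cast le_tsub_add
            _ < v y + d := ENNReal.add_lt_add_right (by simp) hy
      filter_upwards [h1, h2] with y hy1 hy2
      refine ⟨?_, by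
        rw [← EReal.coe_nnreal_eq_coe_real]
        exact EReal.coe_ennreal_lt_coe_ennreal_iff.2 hy2⟩
      have : (u y : ℝ) < u x + d := by exact_mod_cast hy1
      linarith)
  obtain ⟨p, hp⟩ := exists_poly_approx g hd1
  simp only [abs_lt] at hp
  have key := h (p - C ((2 * d : ℝ) : ℂ)) fun x => by
    have h1 : ((g x - d : ℝ) : EReal) ≤ v x := by
      have := (hg x).2.le
      rw [EReal.coe_ennreal_add] at this
      rw [EReal.coe_sub, EReal.sub_le_iff_le_add (by simp) (by simp)]
      exact this
    refine le_trans (EReal.coe_le_coe_iff.2 ?_) h1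
    have := (hp x).2
    simp only [eval_sub, eval_C, sub_re, ofReal_re]
    linarith
  have hkey : ((p - C ((2 * d : ℝ) : ℂ)).eval 0).re ≤ (m : ℝ) := by
    rwa [EReal.coe_nnreal_eq_coe_real, EReal.coe_le_coe_iff] at key
  simp only [eval_sub, eval_C, sub_re, ofReal_re] at hkey
  have hle : ∀ x, (u x : ℝ) ≤ ((p + C ((2 * d : ℝ) : ℂ)).eval (circ x)).re := fun x => by
    have h1 := (hp x).1
    have h2 := (hg x).1
    simp only [eval_add, eval_C, add_re, ofReal_re]
    linarith
  have hu2 : ∫⁻ x, (u x : ENNReal) ∂(AddCircle.haarAddCircle (T := 2 * Real.pi)) ≤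
      ENNReal.ofReal (m + 4 * d) := by
    calc _ ≤ ∫⁻ x, ENNReal.ofReal ((p + C ((2 * d : ℝ) : ℂ)).eval (circ x)).re
            ∂(AddCircle.haarAddCircle (T := 2 * Real.pi)) := lintegral_mono fun x => by
          rw [← ENNReal.ofReal_coe_nnreal]
          exact ENNReal.ofReal_le_ofReal (hle x)
      _ = ENNReal.ofReal ((p + C ((2 * d : ℝ) : ℂ)).eval 0).re := by
          rw [← integral_eval_circ_re, ofReal_integral_eq_lintegral_ofReal
            (integrable_eval_circ_re _)
            (Eventually.of_forall fun x => (u x).coe_nonneg.trans (hle x))]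
      _ ≤ _ := ENNReal.ofReal_le_ofReal (by
          simp only [eval_add, eval_C, add_re, ofReal_re]
          linarith)
  refine h_integ.trans ((add_le_add_left hu2 _).trans ?_)
  rw [show ((m : ℝ) + 4 * d) = ((m + 4 * d : NNReal) : ℝ) by push_cast; ring,
    ENNReal.ofReal_coe_nnreal]
  norm_cast
  rw [add_assoc]
  refine add_le_add_right ?_ _
  rw [← NNReal.coe_le_coe]
  push_cast [hd]
  linarith [ε.coe_nonneg]
/-! ### The local centre form of plurisubharmonicity -/

lemma ereal_add_coe_le_iff {a : EReal} {x y : ℝ} : a + x ≤ y ↔ a ≤ ((y - x : ℝ) : EReal) := by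
  induction a with
  | top => simpa using (lt_top_iff_ne_top.2 (EReal.coe_ne_top (y - x))).not_ge
  | bot => simp
  | coe a => norm_cast; constructor <;> intro h <;> linarith

lemma ereal_lt_add_coe_iff {a : EReal} {x y : ℝ} :
    (y : EReal) < a + x ↔ ((y - x : ℝ) : EReal) < a := by
  simpa using (not_congr (ereal_add_coe_le_iff (a := a) (x := x) (y := y)))

lemma upperSemicontinuousOn_add_coe {X : Type*} [TopologicalSpace X] {s : Set X} {u : X → EReal}
    {f : X → ℝ} (hu : UpperSemicontinuousOn u s) (hf : ContinuousOn f s) :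
    UpperSemicontinuousOn (fun z => u z + (f z : EReal)) s :=
  hu.add' (continuous_coe_real_ereal.comp_continuousOn hf).upperSemicontinuousOn fun x _ =>
    EReal.continuousAt_add (by simp) (by simp)

lemma normSq_add_mul_eq (a ζ : ℂ) (ρ : ℝ) (hζ : ‖ζ‖ = 1) :
    ‖a + ρ * ζ‖ ^ 2 = ‖a‖ ^ 2 + ρ ^ 2 + ((C (2 * ρ * starRingEnd ℂ a) * X : ℂ[X]).eval ζ).re := by
  have h1 : ζ.re * ζ.re + ζ.im * ζ.im = 1 := by
    rw [← Complex.normSq_apply, Complex.normSq_eq_norm_sq, hζ, one_pow]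
  simp only [← Complex.normSq_eq_norm_sq, Complex.normSq_apply]
  simp
  linear_combination ρ ^ 2 * h1

/-- A function on the closed unit disc with the local sub-mean value property satisfies the
maximum principle against real parts of polynomials. -/
lemma disc_max {u : ℂ → EReal} (husc : UpperSemicontinuousOn u (Metric.closedBall 0 1))
    (htop : ∀ ζ, ‖ζ‖ ≤ 1 → u ζ ≠ ⊤)
    (hloc : ∀ ζ₀, ‖ζ₀‖ < 1 → ∃ ρ₀ : ℝ, 0 < ρ₀ ∧ ∀ ρ : ℝ, 0 < ρ → ρ < ρ₀ → ∀ p : ℂ[X],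
      (∀ ζ : ℂ, ‖ζ‖ = 1 → u (ζ₀ + ρ * ζ) ≤ ((p.eval ζ).re : ℝ)) → u ζ₀ ≤ ((p.eval 0).re : ℝ))
    (p : ℂ[X]) (hp : ∀ ζ : ℂ, ‖ζ‖ = 1 → u ζ ≤ ((p.eval ζ).re : ℝ)) :
    ∀ ζ : ℂ, ‖ζ‖ ≤ 1 → u ζ ≤ ((p.eval ζ).re : ℝ) := by
  by_contra! hcon
  obtain ⟨ζ', hζ', hlt⟩ := hcon
  obtain ⟨c, hc1, hc2⟩ := EReal.lt_iff_exists_real_btwn.1 hlt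
  rw [EReal.coe_lt_coe_iff] at hc1
  set ε := (c - (p.eval ζ').re) / 2 with hε
  have hε0 : 0 < ε := by rw [hε]; linarith
  set D : ℂ → EReal := fun ζ => u ζ + ((ε * ‖ζ‖ ^ 2 - (p.eval ζ).re : ℝ) : EReal) with hD
  have hDu : UpperSemicontinuousOn D (Metric.closedBall 0 1) :=
    upperSemicontinuousOn_add_coe husc (Continuous.continuousOn (by
      have := p.continuous; fun_prop))
  obtain ⟨ζ₀, hζ₀, hmax⟩ := hDu.exists_isMaxOn ⟨0, by simp⟩ (isCompact_closedBall 0 1)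
  have hζ₀1 : ‖ζ₀‖ ≤ 1 := by simpa using hζ₀
  have hmax' : ∀ ζ, ‖ζ‖ ≤ 1 → D ζ ≤ D ζ₀ := fun ζ hζ => hmax (by simpa using hζ)
  have hbig : (ε : EReal) < D ζ₀ := by
    refine lt_of_lt_of_le ?_ (hmax' ζ' hζ')
    rw [hD]
    simp only
    rw [ereal_lt_add_coe_iff]
    refine lt_of_le_of_lt (EReal.coe_le_coe_iff.2 ?_) hc2
    nlinarith [sq_nonneg ‖ζ'‖]
  have hbot : u ζ₀ ≠ ⊥ := by
    intro h
    simp [hD, h] at hbig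
  lift u ζ₀ to ℝ using ⟨htop _ hζ₀1, hbot⟩ with U hU
  have hD0 : D ζ₀ = ((U + (ε * ‖ζ₀‖ ^ 2 - (p.eval ζ₀).re) : ℝ) : EReal) := by
    rw [hD]; simp only; rw [← hU]; norm_cast
  have hlt1 : ‖ζ₀‖ < 1 := by
    refine lt_of_le_of_ne hζ₀1 fun h1 => ?_
    have h2 := hp ζ₀ h1
    rw [← hU, EReal.coe_le_coe_iff] at h2
    rw [hD0, EReal.coe_lt_coe_iff, h1] at hbig
    linarith
  set m := U + (ε * ‖ζ₀‖ ^ 2 - (p.eval ζ₀).re) with hm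
  have hle : ∀ ζ, ‖ζ‖ ≤ 1 → u ζ ≤ ((m - (ε * ‖ζ‖ ^ 2 - (p.eval ζ).re) : ℝ) : EReal) :=
    fun ζ hζ => ereal_add_coe_le_iff.1 ((hmax' ζ hζ).trans hD0.le)
  obtain ⟨ρ₀, hρ₀, hl⟩ := hloc ζ₀ hlt1
  obtain ⟨ρ, hρ0, hρ⟩ := exists_between (lt_min hρ₀ (sub_pos.2 hlt1))
  have h3 := hl ρ hρ0 (hρ.trans_le (min_le_left _ _))
    (p.comp (C ζ₀ + C (ρ : ℂ) * X) + C ((m - ε * (‖ζ₀‖ ^ 2 + ρ ^ 2) : ℝ) : ℂ)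
      - C (ε : ℂ) * (C (2 * ρ * starRingEnd ℂ ζ₀) * X)) fun ζ hζ => by
    have hn : ‖ζ₀ + ρ * ζ‖ ≤ 1 := by
      refine (norm_add_le _ _).trans ?_
      rw [norm_mul, hζ, Complex.norm_real, Real.norm_of_nonneg hρ0.le]
      linarith [hρ.trans_le (min_le_right _ _)]
    refine (hle _ hn).trans (EReal.coe_le_coe_iff.2 ?_)
    rw [normSq_add_mul_eq _ _ _ hζ]
    simp only [eval_add, eval_sub, eval_comp, eval_mul, eval_C, eval_X, add_re, sub_re,
      Complex.re_ofReal_mul, ofReal_re]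
    linarith
  rw [← hU, EReal.coe_le_coe_iff] at h3
  simp only [eval_add, eval_sub, eval_comp, eval_mul, eval_C, eval_X, add_re, sub_re,
    ofReal_re, mul_zero, add_zero, zero_re] at h3
  nlinarith [mul_pos hε0 (pow_pos hρ0 2)]

section

variable {n : ℕ}

/-- Plurisubharmonicity up to being identically `-∞`, phrased through centres of discs. -/
structure PreSH (Ω : Set (Fin n → ℂ)) (u : (Fin n → ℂ) → EReal) : Prop where
  usc : UpperSemicontinuousOn u Ω
  ne_top : ∀ z ∈ Ω, u z ≠ ⊤
  center : ∀ z ∈ Ω, ∀ w : Fin n → ℂ, (∀ ζ : ℂ, ‖ζ‖ ≤ 1 → z + ζ • w ∈ Ω) → ∀ p : ℂ[X],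
    (∀ ζ : ℂ, ‖ζ‖ = 1 → u (z + ζ • w) ≤ ((p.eval ζ).re : ℝ)) → u z ≤ ((p.eval 0).re : ℝ)

variable {Ω U : Set (Fin n → ℂ)} {u v : (Fin n → ℂ) → EReal}

lemma IsPSH.preSH (h : IsPSH Ω u) : PreSH Ω u := by
  refine ⟨h.1, h.2.1, fun z hz w hw p hp => ?_⟩
  simpa using h.2.2.2 z hz w 1 one_pos hw p hp 0 (by simp)

lemma PreSH.mono (h : PreSH Ω u) (hU : U ⊆ Ω) : PreSH U u :=
  ⟨h.usc.mono hU, fun z hz => h.ne_top z (hU hz), fun z hz w hw =>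
    h.center z (hU hz) w fun ζ hζ => hU (hw ζ hζ)⟩

lemma PreSH.congr (h : PreSH Ω u) (hv : EqOn v u Ω) : PreSH Ω v := by
  refine ⟨fun x hx y hy => ?_, fun z hz => by rw [hv hz]; exact h.ne_top z hz,
    fun z hz w hw p hp => ?_⟩
  · have hy' : u x < y := by rw [← hv hx]; exact hy
    filter_upwards [h.usc x hx y hy', self_mem_nhdsWithin] with t ht ht2
    rw [hv ht2]; exact ht
  · rw [hv hz]
    exact h.center z hz w hw p fun ζ hζ => by rw [← hv (hw ζ hζ.le)]; exact hp ζ hζ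

lemma continuous_disc_map (z w : Fin n → ℂ) : Continuous fun ζ : ℂ => z + ζ • w := by fun_prop

/-- A locally plurisubharmonic function satisfies the maximum principle on all discs. -/
lemma disc_le_of_local (h : ∀ a ∈ Ω, ∃ U, IsOpen U ∧ a ∈ U ∧ PreSH U u) {z w : Fin n → ℂ}
    (hw : ∀ ζ : ℂ, ‖ζ‖ ≤ 1 → z + ζ • w ∈ Ω) (p : ℂ[X])
    (hp : ∀ ζ : ℂ, ‖ζ‖ = 1 → u (z + ζ • w) ≤ ((p.eval ζ).re : ℝ)) (ζ : ℂ) (hζ : ‖ζ‖ ≤ 1) :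
    u (z + ζ • w) ≤ ((p.eval ζ).re : ℝ) := by
  refine disc_max (u := fun ζ => u (z + ζ • w)) ?_ ?_ ?_ p hp ζ hζ
  · intro ζ hζ y hy
    obtain ⟨U, hU, ha, hpre⟩ := h _ (hw ζ (by simpa using hζ))
    have h1 := hpre.usc _ ha y hy
    rw [hU.nhdsWithin_eq ha] at h1
    exact ((continuous_disc_map z w).continuousAt.eventually h1).filter_mono nhdsWithin_le_nhds
  · intro ζ hζ
    obtain ⟨U, hU, ha, hpre⟩ := h _ (hw ζ hζ)
    exact hpre.ne_top _ ha
  · intro ζ₀ hζ₀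
    obtain ⟨U, hU, ha, hpre⟩ := h _ (hw ζ₀ hζ₀.le)
    have hn : (fun ζ : ℂ => z + ζ • w) ⁻¹' U ∈ 𝓝 ζ₀ :=
      (continuous_disc_map z w).continuousAt (hU.mem_nhds ha)
    obtain ⟨ρ₀, hρ₀, hsub⟩ := Metric.mem_nhds_iff.1 hn
    refine ⟨ρ₀, hρ₀, fun ρ hρ hρ1 q hq => ?_⟩
    have e : ∀ ζ : ℂ, z + ζ₀ • w + ζ • ((ρ : ℂ) • w) = z + (ζ₀ + ρ * ζ) • w := fun ζ => by
      rw [add_smul, smul_smul, mul_comm ζ, add_assoc]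
    refine hpre.center _ ha ((ρ : ℂ) • w) (fun ζ hζ => ?_) q fun ζ hζ => ?_
    · rw [e]
      refine hsub ?_
      rw [Metric.mem_ball, dist_eq_norm, add_sub_cancel_left, norm_mul, Complex.norm_real,
        Real.norm_of_nonneg hρ.le]
      nlinarith
    · rw [e]; exact hq ζ hζ

lemma PreSH.of_local (h : ∀ a ∈ Ω, ∃ U, IsOpen U ∧ a ∈ U ∧ PreSH U u) : PreSH Ω u := by
  refine ⟨fun a ha y hy => ?_, fun a ha => ?_, fun z hz w hw p hp => ?_⟩
  · obtain ⟨U, hU, haU, hpre⟩ := h a ha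
    have h1 := hpre.usc a haU y hy
    rw [hU.nhdsWithin_eq haU] at h1
    exact h1.filter_mono nhdsWithin_le_nhds
  · obtain ⟨U, hU, haU, hpre⟩ := h a ha
    exact hpre.ne_top a haU
  · simpa using disc_le_of_local h hw p hp 0 (by simp)

lemma PreSH.isPSH (hΩ : IsOpen Ω) (h : PreSH Ω u) (hne : ∃ z ∈ Ω, u z ≠ ⊥) : IsPSH Ω u := by
  refine ⟨h.usc, h.ne_top, hne, fun z hz w r hr hw p hp ζ hζ => ?_⟩
  have hr' : (r : ℂ) ≠ 0 := by exact_mod_cast hr.ne'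
  have hnr : ‖(r : ℂ)‖ = r := by rw [Complex.norm_real, Real.norm_of_nonneg hr.le]
  have key := disc_le_of_local (Ω := Ω) (u := u) (fun a ha => ⟨Ω, hΩ, ha, h⟩) (z := z)
    (w := (r : ℂ) • w) (fun ζ hζ => by
      rw [smul_smul]; exact hw _ (by rw [norm_mul, hnr]; nlinarith)) (p.comp (C (r : ℂ) * X))
    (fun ζ hζ => by
      rw [smul_smul]
      simp only [eval_comp, eval_mul, eval_C, eval_X]
      rw [mul_comm (r : ℂ)]
      exact hp (ζ * r) (by rw [norm_mul, hnr, hζ, one_mul]))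
    (ζ / r) (by rw [norm_div, hnr]; exact div_le_one_of_le₀ hζ hr.le)
  rw [smul_smul, div_mul_cancel₀ _ hr'] at key
  simpa [mul_div_cancel₀ _ hr'] using key

lemma PreSH.const (Ω : Set (Fin n → ℂ)) (c : ℝ) : PreSH Ω fun _ => (c : EReal) :=
  ⟨continuousOn_const.upperSemicontinuousOn, fun _ _ => EReal.coe_ne_top _,
    fun z _ w _ p hp => by
      have := eval_zero_re_mono (C (c : ℂ)) p 0 fun ζ hζ => by
        simpa using EReal.coe_le_coe_iff.1 (hp ζ hζ)
      exact EReal.coe_le_coe_iff.2 (by simpa using this)⟩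

lemma PreSH.sup (hu : PreSH Ω u) (hv : PreSH Ω v) : PreSH Ω fun z => max (u z) (v z) :=
  ⟨hu.usc.sup hv.usc, fun z hz => (max_lt (lt_top_iff_ne_top.2 (hu.ne_top z hz))
      (lt_top_iff_ne_top.2 (hv.ne_top z hz))).ne, fun z hz w hw p hp =>
    max_le (hu.center z hz w hw p fun ζ hζ => (le_max_left _ _).trans (hp ζ hζ))
      (hv.center z hz w hw p fun ζ hζ => (le_max_right _ _).trans (hp ζ hζ))⟩

lemma PreSH.add (hu : PreSH Ω u) (hv : PreSH Ω v) : PreSH Ω fun z => u z + v z := by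
  refine ⟨hu.usc.add' hv.usc fun x hx => EReal.continuousAt_add (Or.inl (hu.ne_top x hx))
    (Or.inr (hv.ne_top x hx)), fun z hz => ?_, fun z hz w hw p hp => ?_⟩
  · exact EReal.add_ne_top (hu.ne_top z hz) (hv.ne_top z hz)
  · have hm : ∀ x, z + circ x • w ∈ Ω := fun x => hw _ (norm_circ x).le
    have hc : Continuous fun x => z + circ x • w :=
      (continuous_disc_map z w).comp continuous_circ
    have husc : ∀ {f : (Fin n → ℂ) → EReal}, UpperSemicontinuousOn f Ω →
        UpperSemicontinuous fun x => f (z + circ x • w) := fun hf x y hy =>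
      (tendsto_nhdsWithin_of_tendsto_nhds_of_eventually_within _ hc.continuousAt
        (Eventually.of_forall hm)).eventually (hf _ (hm x) y hy)
    have key : ∀ ε : ℝ, 0 < ε → u z + v z ≤ (((p.eval 0).re + ε : ℝ) : EReal) := fun ε hε => by
      obtain ⟨q₁, q₂, h1, h2, h3⟩ := exists_poly_pair _ _ (husc hu.usc) (husc hv.usc)
        (fun x => hu.ne_top _ (hm x)) (fun x => hv.ne_top _ (hm x)) p
        (fun x => hp _ (norm_circ x)) hε
      refine (add_le_add (hu.center z hz w hw q₁ fun ζ hζ => ?_)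
        (hv.center z hz w hw q₂ fun ζ hζ => ?_)).trans (by exact_mod_cast h3)
      · obtain ⟨x, rfl⟩ := exists_circ_eq hζ; exact h1 x
      · obtain ⟨x, rfl⟩ := exists_circ_eq hζ; exact h2 x
    refine EReal.le_of_forall_lt_iff_le.1 fun c hc => ?_
    have := key (c - (p.eval 0).re) (by rw [EReal.coe_lt_coe_iff] at hc; linarith)
    simpa using this

lemma PreSH.add_const (hu : PreSH Ω u) (c : ℝ) : PreSH Ω fun z => u z + (c : EReal) :=
  hu.add (PreSH.const Ω c)

lemma PreSH.translate (hu : PreSH Ω u) (y : Fin n → ℂ) :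
    PreSH ((fun z => z + y) ⁻¹' Ω) fun z => u (z + y) := by
  refine ⟨fun a ha c hc => ?_, fun z hz => hu.ne_top _ hz, fun z hz w hw p hp => ?_⟩
  · exact (tendsto_nhdsWithin_of_tendsto_nhds_of_eventually_within _
      ((continuous_add_const y).continuousAt.mono_left nhdsWithin_le_nhds)
      self_mem_nhdsWithin).eventually (hu.usc _ ha c hc)
  · refine hu.center _ hz w (fun ζ hζ => ?_) p fun ζ hζ => ?_
    · rw [add_right_comm]; exact hw ζ hζ
    · rw [add_right_comm]; exact hp ζ hζ

end

/-! ### Maximum principles -/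

section

variable {n : ℕ} {Ω : Set (Fin n → ℂ)} {w : (Fin n → ℂ) → EReal}

/-- A plurisubharmonic function lying below `F` outside a compact set lies below `F` everywhere,
when `F` is locally constant in some coordinate direction at every point. -/
lemma PreSH.le_of_le_off_compact (hw : PreSH Ω w) (hΩ : IsOpen Ω) (hb : Bornology.IsBounded Ω)
    {K : Set (Fin n → ℂ)} (hK : IsCompact K) (hKΩ : K ⊆ Ω) {F : (Fin n → ℂ) → ℝ}
    (husc : UpperSemicontinuousOn (fun z => w z + ((-F z : ℝ) : EReal)) K)
    (hF : ∀ z ∈ K, ∃ i : Fin n, ∃ ρ₀ > 0, ∀ ρ : ℝ, 0 < ρ → ρ < ρ₀ → ∀ ζ : ℂ, ‖ζ‖ = 1 →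
      F (z + ζ • Pi.single i (ρ : ℂ)) = F z)
    (hoff : ∀ z ∈ Ω \ K, w z ≤ F z) : ∀ z ∈ Ω, w z ≤ F z := by
  by_contra! hcon
  obtain ⟨z', hz', hlt⟩ := hcon
  have hz'K : z' ∈ K := by
    by_contra h
    exact (hoff z' ⟨hz', h⟩).not_gt hlt
  obtain ⟨c, hc1, hc2⟩ := EReal.lt_iff_exists_real_btwn.1 hlt
  rw [EReal.coe_lt_coe_iff] at hc1
  set q : (Fin n → ℂ) → ℝ := fun z => ∑ j, ‖z j‖ ^ 2 with hq
  have hq0 : ∀ z, 0 ≤ q z := fun z => Finset.sum_nonneg fun j _ => by positivity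
  have hqc : Continuous q := by rw [hq]; fun_prop
  obtain ⟨R, hR⟩ : ∃ R, ∀ z ∈ Ω, q z ≤ R := by
    obtain ⟨M, hM⟩ := hb.exists_norm_le
    refine ⟨∑ _j : Fin n, M ^ 2, fun z hz => Finset.sum_le_sum fun j _ => ?_⟩
    have := (norm_le_pi_norm z j).trans (hM z hz)
    gcongr
  have hR0 : 0 ≤ R := (hq0 _).trans (hR z' hz')
  set ε := (c - F z') / (R + 1) with hε
  have hε0 : 0 < ε := div_pos (by linarith) (by linarith)
  have hεR : ε * R < c - F z' := by
    have : ε * (R + 1) = c - F z' := div_mul_cancel₀ _ (by linarith)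
    nlinarith
  set D : (Fin n → ℂ) → EReal := fun z => w z + ((-F z : ℝ) : EReal) + ((ε * q z : ℝ) : EReal)
    with hD
  have hDu : UpperSemicontinuousOn D K :=
    upperSemicontinuousOn_add_coe husc (by fun_prop)
  obtain ⟨z₁, hz₁, hmax⟩ := hDu.exists_isMaxOn ⟨z', hz'K⟩ hK
  have hDz : ∀ z, D z = w z + ((ε * q z - F z : ℝ) : EReal) := fun z => by
    rw [hD]
    simp only
    rw [add_assoc, ← EReal.coe_add]
    congr 2
    ring
  have hbig : ((ε * R : ℝ) : EReal) < D z₁ := by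
    refine lt_of_lt_of_le ?_ (hmax hz'K)
    rw [hDz, ereal_lt_add_coe_iff]
    refine lt_of_le_of_lt (EReal.coe_le_coe_iff.2 ?_) hc2
    nlinarith [hq0 z']
  have hbot : w z₁ ≠ ⊥ := by
    intro h
    simp [hDz, h] at hbig
  lift w z₁ to ℝ using ⟨hw.ne_top _ (hKΩ hz₁), hbot⟩ with W hW
  have hD1 : D z₁ = ((W + (ε * q z₁ - F z₁) : ℝ) : EReal) := by
    rw [hDz, ← hW]; norm_cast
  rw [hD1, EReal.coe_lt_coe_iff] at hbig
  obtain ⟨i, ρ₀, hρ₀, hFi⟩ := hF z₁ hz₁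
  obtain ⟨r, hr, hball⟩ := Metric.isOpen_iff.1 hΩ z₁ (hKΩ hz₁)
  obtain ⟨ρ, hρ, hρ1⟩ := exists_between (lt_min hρ₀ hr)
  have hmem : ∀ ζ : ℂ, ‖ζ‖ ≤ 1 → z₁ + ζ • Pi.single i (ρ : ℂ) ∈ Ω := fun ζ hζ => hball (by
    rw [Metric.mem_ball, dist_eq_norm, add_sub_cancel_left, norm_smul, Pi.norm_single,
      Complex.norm_real, Real.norm_of_nonneg hρ.le]
    nlinarith [hρ1.trans_le (min_le_right _ _)])
  have hqe : ∀ ζ : ℂ, ‖ζ‖ = 1 → q (z₁ + ζ • Pi.single i (ρ : ℂ)) =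
      q z₁ + ρ ^ 2 + ((C (2 * ρ * starRingEnd ℂ (z₁ i)) * X : ℂ[X]).eval ζ).re := fun ζ hζ => by
    rw [hq]
    simp only
    rw [← Finset.add_sum_erase _ _ (Finset.mem_univ i),
      ← Finset.add_sum_erase (a := i) _ (fun j => ‖z₁ j‖ ^ 2) (Finset.mem_univ i)]
    have h1 := normSq_add_mul_eq (z₁ i) ζ ρ hζ
    have h2 : ∑ x ∈ Finset.univ.erase i, ‖(z₁ + ζ • (Pi.single i (ρ : ℂ) : Fin n → ℂ)) x‖ ^ 2 =
        ∑ x ∈ Finset.univ.erase i, ‖z₁ x‖ ^ 2 := Finset.sum_congr rfl fun x hx => by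
      simp [Pi.single_eq_of_ne (Finset.ne_of_mem_erase hx)]
    rw [h2]
    simp only [Pi.add_apply, Pi.smul_apply, Pi.single_eq_same, smul_eq_mul]
    rw [mul_comm ζ, h1]
    ring
  have key := hw.center z₁ (hKΩ hz₁) (Pi.single i (ρ : ℂ)) hmem
    (C ((W + ε * q z₁ - ε * (q z₁ + ρ ^ 2) : ℝ) : ℂ)
      - C (ε : ℂ) * (C (2 * ρ * starRingEnd ℂ (z₁ i)) * X)) fun ζ hζ => by
    have hFz := hFi ρ hρ (hρ1.trans_le (min_le_left _ _)) ζ hζ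
    have hm := hmem ζ hζ.le
    have hv : ∀ a, (a - C (ε : ℂ) * (C (2 * ρ * starRingEnd ℂ (z₁ i)) * X)).eval ζ =
      a.eval ζ - ε * (C (2 * ρ * starRingEnd ℂ (z₁ i)) * X : ℂ[X]).eval ζ := fun a => by simp
    rw [hv, eval_C, sub_re, ofReal_re, Complex.re_ofReal_mul]
    have hqz := hqe ζ hζ
    by_cases hx : z₁ + ζ • Pi.single i (ρ : ℂ) ∈ K
    · have h3 : D _ ≤ D z₁ := hmax hx
      rw [hD1, hDz, ereal_add_coe_le_iff, hFz, hqz] at h3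
      exact h3.trans (EReal.coe_le_coe_iff.2 (by linarith))
    · refine (hoff _ ⟨hm, hx⟩).trans (EReal.coe_le_coe_iff.2 ?_)
      have := hR _ hm
      rw [hFz]
      nlinarith
  rw [← hW, EReal.coe_le_coe_iff] at key
  simp only [eval_sub, eval_mul, eval_C, eval_X, sub_re, ofReal_re, mul_zero, zero_re] at key
  nlinarith [mul_pos hε0 (pow_pos hρ 2)]

lemma PreSH.nonpos_of_nonpos_off_compact (hw : PreSH Ω w) (hΩ : IsOpen Ω)
    (hb : Bornology.IsBounded Ω) (i : Fin n) {K : Set (Fin n → ℂ)} (hK : IsCompact K)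
    (hKΩ : K ⊆ Ω) (hoff : ∀ z ∈ Ω \ K, w z ≤ 0) : ∀ z ∈ Ω, w z ≤ 0 := by
  have := hw.le_of_le_off_compact hΩ hb hK hKΩ (F := fun _ => 0) (by simpa using hw.usc.mono hKΩ)
    (fun z _ => ⟨i, 1, one_pos, fun _ _ _ _ _ => rfl⟩) (by simpa using hoff)
  simpa using this

end

/-! ### Nonnegative plurisuperharmonic functions and volume means -/

section

open MeasureTheory

section

variable {n : ℕ} {Ω U : Set (Fin n → ℂ)} {u v : (Fin n → ℂ) → EReal} {f : (Fin n → ℂ) → ENNReal}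

/-- Nonnegative plurisuperharmonicity, allowing `f ≡ ∞`, phrased through circle means. -/
structure PosSH (Ω : Set (Fin n → ℂ)) (f : (Fin n → ℂ) → ENNReal) : Prop where
  lsc : LowerSemicontinuousOn f Ω
  mean : ∀ z ∈ Ω, ∀ w : Fin n → ℂ, (∀ ζ : ℂ, ‖ζ‖ ≤ 1 → z + ζ • w ∈ Ω) →
    ∫⁻ x, f (z + circ x • w) ∂AddCircle.haarAddCircle ≤ f z

lemma PosSH.mono (h : PosSH Ω f) (hU : U ⊆ Ω) : PosSH U f :=
  ⟨h.lsc.mono hU, fun z hz w hw => h.mean z (hU hz) w fun ζ hζ => hU (hw ζ hζ)⟩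

lemma LowerSemicontinuousOn.comp_circle (hf : LowerSemicontinuousOn f Ω) {z w : Fin n → ℂ}
    (hw : ∀ ζ : ℂ, ‖ζ‖ ≤ 1 → z + ζ • w ∈ Ω) :
    LowerSemicontinuous fun x => f (z + circ x • w) := by
  have hm : ∀ x, z + circ x • w ∈ Ω := fun x => hw _ (norm_circ x).le
  have hc : Continuous fun x => z + circ x • w :=
    (continuous_disc_map z w).comp continuous_circ
  exact fun x y hy => (tendsto_nhdsWithin_of_tendsto_nhds_of_eventually_within _ hc.continuousAt
        (Eventually.of_forall hm)).eventually (hf _ (hm x) y hy)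

lemma lowerSemicontinuousOn_of_neg (h : UpperSemicontinuousOn (fun z => -v z) Ω) :
    LowerSemicontinuousOn v Ω := by
  have := continuous_neg.comp_upperSemicontinuousOn_antitone h fun _ _ => EReal.neg_le_neg_iff.2
  simpa [Function.comp_def] using this

lemma upperSemicontinuousOn_neg (h : LowerSemicontinuousOn v Ω) :
    UpperSemicontinuousOn (fun z => -v z) Ω :=
  continuous_neg.comp_lowerSemicontinuousOn_antitone h fun _ _ => EReal.neg_le_neg_iff.2

lemma PreSH.posSH (h : PreSH Ω fun z => -v z) (h0 : ∀ z ∈ Ω, 0 ≤ v z) :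
    PosSH Ω fun z => (v z).toENNReal := by
  have hl : LowerSemicontinuousOn (fun z => (v z).toENNReal) Ω :=
    EReal.continuous_toENNReal.comp_lowerSemicontinuousOn (lowerSemicontinuousOn_of_neg h.usc)
      fun _ _ => EReal.toENNReal_le_toENNReal
  refine ⟨hl, fun z hz w hw => lintegral_circ_le _ (hl.comp_circle hw) _ fun p hp => ?_⟩
  have hm : ∀ x, z + circ x • w ∈ Ω := fun x => hw _ (norm_circ x).le
  rw [EReal.coe_toENNReal (h0 z hz)]
  have := h.center z hz w hw (-p) fun ζ hζ => by
    obtain ⟨x, rfl⟩ := exists_circ_eq hζ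
    have := hp x
    rw [EReal.coe_toENNReal (h0 _ (hm x))] at this
    rw [eval_neg, neg_re, EReal.coe_neg]
    exact EReal.neg_le_neg_iff.2 this
  rw [eval_neg, neg_re, EReal.coe_neg] at this
  exact EReal.neg_le_neg_iff.1 this

lemma PosSH.preSH (h : PosSH Ω f) : PreSH Ω fun z => -(f z : EReal) := by
  refine ⟨upperSemicontinuousOn_neg (continuous_coe_ennreal_ereal.comp_lowerSemicontinuousOn h.lsc
    EReal.coe_ennreal_strictMono.monotone), fun z hz => ?_, fun z hz w hw p hp => ?_⟩
  · rw [Ne, EReal.neg_eq_top_iff]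
    exact EReal.coe_ennreal_ne_bot _
  · have h1 : (-(p.eval 0).re : ℝ) ≤ (f z : EReal) := by
      have h2 : ENNReal.ofReal (-(p.eval 0).re) ≤ f z := by
        refine le_trans ?_ (h.mean z hz w hw)
        have h_integ : Integrable (fun x => max (-(p.eval (circ x)).re) 0)
            (AddCircle.haarAddCircle (T := 2 * Real.pi)) := (integrable_eval_circ_re p).neg.pos_part
        have hle : -(p.eval 0).re ≤ ∫ x, max (-(p.eval (circ x)).re) 0
            ∂(AddCircle.haarAddCircle (T := 2 * Real.pi)) := by
          rw [← integral_eval_circ_re, ← integral_neg]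
          exact integral_mono (integrable_eval_circ_re p).neg
            h_integ fun x => le_max_left _ _
        refine (ENNReal.ofReal_le_ofReal hle).trans ?_
        rw [ofReal_integral_eq_lintegral_ofReal h_integ
          (Eventually.of_forall fun x => le_max_right _ _)]
        refine lintegral_mono fun x => ?_
        have h3 := hp _ (norm_circ x)
        rw [EReal.neg_le, ← EReal.coe_neg] at h3
        rw [← EReal.coe_ennreal_le_coe_ennreal_iff, EReal.coe_ennreal_ofReal, max_eq_left
          (le_max_right _ _)]
        rcases max_cases (-(p.eval (circ x)).re) 0 with h4 | h4 <;> rw [h4.1]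
        · exact h3
        · exact EReal.coe_ennreal_nonneg _
      rw [← EReal.coe_ennreal_le_coe_ennreal_iff, EReal.coe_ennreal_ofReal] at h2
      exact (EReal.coe_le_coe_iff.2 (le_max_left _ _)).trans h2
    rw [EReal.coe_neg] at h1
    exact EReal.neg_le_neg_iff.1 (by simpa using h1)

lemma PosSH.tsum {f : ℕ → (Fin n → ℂ) → ENNReal} (h : ∀ j, PosSH Ω (f j)) :
    PosSH Ω fun z => ∑' j, f j z := by
  refine ⟨lowerSemicontinuousOn_tsum fun j => (h j).lsc, fun z hz w hw => ?_⟩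
  rw [lintegral_tsum fun j => ((h j).lsc.comp_circle hw).measurable.aemeasurable]
  exact ENNReal.tsum_le_tsum fun j => (h j).mean z hz w hw

lemma measurePreserving_circ_smul (x : UnitCirc) :
    MeasurePreserving (fun y : Fin n → ℂ => circ x • y) := by
  have : MeasurePreserving fun (y : Fin n → ℂ) i => rotation (AddCircle.toCircle x) (y i) :=
    volume_preserving_pi fun _ => (rotation (AddCircle.toCircle x)).measurePreserving
  exact this

lemma LowerSemicontinuousOn.indicator_of_isOpen (hf : LowerSemicontinuousOn f U) (hU : IsOpen U) :
    LowerSemicontinuous (U.indicator f) := by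
  intro x y hy
  by_cases hx : x ∈ U
  · rw [indicator_of_mem hx] at hy
    have := hf x hx y hy
    rw [hU.nhdsWithin_eq hx] at this
    filter_upwards [this, hU.mem_nhds hx] with z hz hzU
    rwa [indicator_of_mem hzU]
  · rw [indicator_of_notMem hx] at hy
    exact (not_lt_zero hy).elim

lemma PosSH.measurable_indicator (h : PosSH U f) (hU : IsOpen U) : Measurable (U.indicator f) :=
  (h.lsc.indicator_of_isOpen hU).measurable

lemma PosSH.lintegral_ball_le {a : Fin n → ℂ} {r : ℝ} (h : PosSH (Metric.ball a r) f) :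
    ∫⁻ z in Metric.ball a r, f z ≤ volume (Metric.ball a r) * f a := by
  set g : (Fin n → ℂ) → ENNReal := (Metric.ball a r).indicator f with hg
  have hgm : Measurable g := h.measurable_indicator Metric.isOpen_ball
  have hmem : ∀ y : Fin n → ℂ, ∀ ζ : ℂ, a + ζ • y ∈ Metric.ball a r ↔ ‖ζ‖ * ‖y‖ < r := fun y ζ => by
    simp [norm_smul]
  have e1 : ∫⁻ z in Metric.ball a r, f z = ∫⁻ y, g (a + y) := by
    rw [lintegral_add_left_eq_self g a, hg, lintegral_indicator Metric.isOpen_ball.measurableSet]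
  have e2 : ∀ x, ∫⁻ y, g (a + circ x • y) = ∫⁻ y, g (a + y) := fun x =>
    (measurePreserving_circ_smul x).lintegral_comp (f := fun y => g (a + y)) (by fun_prop)
  have hmeas : Measurable (Function.uncurry fun (x : UnitCirc) (y : Fin n → ℂ) =>
      g (a + circ x • y)) :=
    hgm.comp (by
      have := continuous_circ
      exact Continuous.measurable (by fun_prop))
  have e3 : ∫⁻ y, g (a + y) = ∫⁻ y, ∫⁻ x, g (a + circ x • y) ∂AddCircle.haarAddCircle := by
    rw [← lintegral_lintegral_swap hmeas.aemeasurable]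
    simp [e2]
  have e4 : ∀ y, ∫⁻ x, g (a + circ x • y) ∂AddCircle.haarAddCircle ≤
      (Metric.ball a r).indicator (fun _ => f a) (a + y) := fun y => by
    by_cases hy : ‖y‖ < r
    · rw [indicator_of_mem (by simpa using hy)]
      refine le_trans (lintegral_mono fun x => indicator_le_self _ _ _) (h.mean a ?_ y ?_)
      · simpa using (norm_nonneg _).trans_lt hy
      · intro ζ hζ
        rw [hmem]
        nlinarith [norm_nonneg y]
    · have : ∀ x, g (a + circ x • y) = 0 := fun x => by
        rw [hg, indicator_of_notMem]
        rwa [hmem, norm_circ, one_mul]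
      simp [this]
  rw [e1, e3]
  refine (lintegral_mono e4).trans ?_
  rw [lintegral_add_left_eq_self (fun y => (Metric.ball a r).indicator (fun _ => f a) y) a,
    lintegral_indicator Metric.isOpen_ball.measurableSet, setLIntegral_const, mul_comm]

end

/-! ### Consequences of the volume mean inequality -/

section

variable {n : ℕ} {Ω U K : Set (Fin n → ℂ)} {u v : (Fin n → ℂ) → EReal}
  {f : (Fin n → ℂ) → ENNReal}

lemma PreSH.exists_le_on_compact (hu : PreSH Ω u) (hK : IsCompact K) (hKΩ : K ⊆ Ω) :
    ∃ M : ℝ, ∀ z ∈ K, u z ≤ M := by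
  rcases K.eq_empty_or_nonempty with rfl | hne
  · exact ⟨0, by simp⟩
  · obtain ⟨z, hz, hmax⟩ := (hu.usc.mono hKΩ).exists_isMaxOn hne hK
    obtain ⟨M, hM, -⟩ := EReal.lt_iff_exists_real_btwn.1
      (lt_top_iff_ne_top.2 (hu.ne_top z (hKΩ hz)))
    exact ⟨M, fun y hy => (hmax hy).trans hM.le⟩

lemma PreSH.posSH_const_sub (hu : PreSH U u) {M : ℝ} (hM : ∀ z ∈ U, u z ≤ M) :
    PosSH U fun z => ((M : EReal) - u z).toENNReal := by
  refine PreSH.posSH ((hu.add_const (-M)).congr fun z _ => ?_) fun z hz => ?_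
  · simp only
    rw [EReal.neg_sub (Or.inl (EReal.coe_ne_bot _)) (Or.inl (EReal.coe_ne_top _)), add_comm,
      EReal.coe_neg, add_comm]
  · exact (EReal.sub_nonneg (Or.inl (EReal.coe_ne_top _)) (Or.inl (EReal.coe_ne_bot _))).2
      (hM z hz)

lemma PosSH.aemeasurable (h : PosSH U f) (hU : IsOpen U) : AEMeasurable f (volume.restrict U) :=
  (aemeasurable_indicator_iff hU.measurableSet).1 (h.measurable_indicator hU).aemeasurable

lemma PreSH.mean_le {a : Fin n → ℂ} {r : ℝ} (hu : PreSH (Metric.ball a r) u)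
    (h0 : ∀ z ∈ Metric.ball a r, 0 ≤ u z) {M : ℝ} (hM : ∀ z ∈ Metric.ball a r, u z ≤ M)
    (hr : 0 < r) :
    volume (Metric.ball a r) * (u a).toENNReal ≤ ∫⁻ z in Metric.ball a r, (u z).toENNReal := by
  have hp := hu.posSH_const_sub hM
  have ha : a ∈ Metric.ball a r := Metric.mem_ball_self hr
  have hsum : ∀ z ∈ Metric.ball a r,
      ((M : EReal) - u z).toENNReal + (u z).toENNReal = ENNReal.ofReal M := fun z hz => by
    have h1 := h0 z hz
    have h2 := hM z hz
    lift u z to ℝ using ⟨hu.ne_top z hz, fun h => by simp [h] at h1⟩ with t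
    rw [EReal.coe_nonneg] at h1
    rw [EReal.coe_le_coe_iff] at h2
    rw [← EReal.coe_sub, EReal.toENNReal_of_ne_top (EReal.coe_ne_top _),
      EReal.toENNReal_of_ne_top (EReal.coe_ne_top _), EReal.toReal_coe, EReal.toReal_coe,
      ← ENNReal.ofReal_add (by linarith) h1, sub_add_cancel]
  have h_integ := hp.lintegral_ball_le
  have htot : ∫⁻ z in Metric.ball a r, ENNReal.ofReal M =
      (∫⁻ z in Metric.ball a r, ((M : EReal) - u z).toENNReal) +
        ∫⁻ z in Metric.ball a r, (u z).toENNReal := by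
    rw [← lintegral_add_left' (hp.aemeasurable Metric.isOpen_ball)]
    exact setLIntegral_congr_fun Metric.isOpen_ball.measurableSet fun z hz => (hsum z hz).symm
  rw [setLIntegral_const, ← hsum a ha, mul_comm, mul_add] at htot
  have hfin : volume (Metric.ball a r) * ((M : EReal) - u a).toENNReal ≠ ⊤ :=
    ENNReal.mul_ne_top measure_ball_lt_top.ne
      (ne_top_of_le_ne_top ENNReal.ofReal_ne_top (le_self_add.trans (hsum a ha).le))
  refine (ENNReal.add_le_add_iff_left hfin).1 ?_
  rw [htot]
  gcongr

lemma PreSH.le_of_ae_le {a : Fin n → ℂ} {r : ℝ} (hu : PreSH (Metric.ball a r) u) (hr : 0 < r)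
    {c : ℝ} (hc : ∀ᵐ z ∂volume.restrict (Metric.ball a r), u z ≤ c) : u a ≤ c := by
  have hsub : Metric.ball a (r / 2) ⊆ Metric.ball a r := Metric.ball_subset_ball (by linarith)
  have hw : PreSH (Metric.ball a r) fun z => max (u z + ((-c : ℝ) : EReal)) ((0 : ℝ) : EReal) :=
    (hu.add_const _).sup (PreSH.const _ 0)
  obtain ⟨M, hM⟩ := hw.exists_le_on_compact (isCompact_closedBall a (r / 2))
    (Metric.closedBall_subset_ball (by linarith))
  have h1 := (hw.mono hsub).mean_le (fun z _ => le_max_right _ _)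
    (fun z hz => hM z (Metric.ball_subset_closedBall hz)) (by linarith)
  have h2 : ∫⁻ z in Metric.ball a (r / 2),
      (max (u z + ((-c : ℝ) : EReal)) ((0 : ℝ) : EReal)).toENNReal = 0 := by
    rw [← lintegral_zero]
    refine lintegral_congr_ae ?_
    filter_upwards [ae_restrict_of_ae_restrict_of_subset hsub hc] with z hz
    refine EReal.toENNReal_of_nonpos (max_le ?_ le_rfl)
    rw [← EReal.coe_zero, ereal_add_coe_le_iff]
    simpa using hz
  rw [h2, nonpos_iff_eq_zero, mul_eq_zero] at h1
  rcases h1 with h1 | h1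
  · exact absurd h1 (Metric.measure_ball_pos _ _ (by linarith)).ne'
  · rw [EReal.toENNReal_eq_zero_iff, ← EReal.coe_zero] at h1
    have := ereal_add_coe_le_iff.1 ((le_max_left _ _).trans h1)
    simpa using this

/-- A nonnegative plurisuperharmonic function that is finite somewhere on a domain is locally
integrable. -/
lemma PosSH.exists_lintegral_ball_lt_top (hf : PosSH Ω f) (hΩ : IsOpen Ω)
    (hc : IsPreconnected Ω) (hne : ∃ z ∈ Ω, f z ≠ ⊤) {z : Fin n → ℂ} (hz : z ∈ Ω) :
    ∃ r > 0, Metric.ball z r ⊆ Ω ∧ ∫⁻ y in Metric.ball z r, f y < ⊤ := by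
  set A : Set (Fin n → ℂ) :=
    {z | ∃ r > 0, Metric.ball z r ⊆ Ω ∧ ∫⁻ y in Metric.ball z r, f y < ⊤} with hA
  have hball : ∀ b r, f b ≠ ⊤ → Metric.ball b r ⊆ Ω → ∫⁻ y in Metric.ball b r, f y < ⊤ :=
    fun b r hb hbr => ((hf.mono hbr).lintegral_ball_le).trans_lt
      (ENNReal.mul_lt_top measure_ball_lt_top hb.lt_top)
  have hAo : IsOpen A := by
    rw [Metric.isOpen_iff]
    rintro a ⟨r, hr, hrΩ, hfin⟩
    refine ⟨r / 2, by positivity, fun b hb => ?_⟩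
    have hsub : Metric.ball b (r / 2) ⊆ Metric.ball a r := by
      refine Metric.ball_subset_ball' ?_
      rw [Metric.mem_ball] at hb
      linarith
    exact ⟨r / 2, by positivity, hsub.trans hrΩ, (lintegral_mono_set hsub).trans_lt hfin⟩
  refine hc.subset_of_closure_inter_subset hAo ?_ ?_ hz
  · obtain ⟨b, hb, hfb⟩ := hne
    obtain ⟨r, hr, hrΩ⟩ := Metric.isOpen_iff.1 hΩ b hb
    exact ⟨b, hb, r, hr, hrΩ, hball b r hfb hrΩ⟩
  · rintro z ⟨hzA, hzΩ⟩
    obtain ⟨r, hr, hrΩ⟩ := Metric.isOpen_iff.1 hΩ z hzΩ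
    obtain ⟨a, ⟨s, hs, -, hfin⟩, haz⟩ := Metric.mem_closure_iff.1 hzA (r / 6) (by positivity)
    set t := min s (r / 6) with ht
    have ht0 : 0 < t := lt_min hs (by positivity)
    have hfint : ∫⁻ y in Metric.ball a t, f y < ⊤ :=
      (lintegral_mono_set (Metric.ball_subset_ball (min_le_left _ _))).trans_lt hfin
    obtain ⟨b, hb, hfb⟩ : ∃ b ∈ Metric.ball a t, f b ≠ ⊤ := by
      by_contra! h
      rw [setLIntegral_congr_fun Metric.isOpen_ball.measurableSet h, setLIntegral_const,
        ENNReal.top_mul (Metric.measure_ball_pos _ _ ht0).ne'] at hfint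
      exact lt_irrefl _ hfint
    have hbz : dist b z < r / 3 := by
      have h1 := dist_triangle b a z
      rw [Metric.mem_ball] at hb
      have h2 := min_le_right s (r / 6)
      rw [dist_comm z a] at haz
      linarith
    have hbΩ : Metric.ball b (2 * r / 3) ⊆ Ω :=
      (Metric.ball_subset_ball' (by linarith)).trans hrΩ
    have hsub : Metric.ball z (r / 3) ⊆ Metric.ball b (2 * r / 3) :=
      Metric.ball_subset_ball' (by rw [dist_comm]; linarith)
    exact ⟨r / 3, by positivity, hsub.trans hbΩ,
      (lintegral_mono_set hsub).trans_lt (hball b _ hfb hbΩ)⟩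

lemma PosSH.ae_lt_top (hf : PosSH Ω f) (hΩ : IsOpen Ω) (hc : IsPreconnected Ω)
    (hne : ∃ z ∈ Ω, f z ≠ ⊤) {z : Fin n → ℂ} (hz : z ∈ Ω) :
    ∃ r > 0, Metric.ball z r ⊆ Ω ∧ ∀ᵐ y ∂volume.restrict (Metric.ball z r), f y < ⊤ := by
  obtain ⟨r, hr, hrΩ, hfin⟩ := hf.exists_lintegral_ball_lt_top hΩ hc hne hz
  exact ⟨r, hr, hrΩ, ae_lt_top' ((hf.mono hrΩ).aemeasurable Metric.isOpen_ball) hfin.ne⟩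

end

/-! ### Boundary data and Perron–Bremermann envelopes -/

lemma ereal_le_coe_of_forall_pos {a : EReal} {c : ℝ}
    (h : ∀ ε : ℝ, 0 < ε → a ≤ ((c + ε : ℝ) : EReal)) :
    a ≤ c := by
  refine EReal.le_of_forall_lt_iff_le.1 fun d hd => ?_
  rw [EReal.coe_lt_coe_iff] at hd
  simpa using h (d - c) (by linarith)

section

variable {n : ℕ} {Ω U K : Set (Fin n → ℂ)} {u v h : (Fin n → ℂ) → EReal}

/-- Nonnegative plurisuperharmonic functions extending continuously to the closure. -/
structure BdryData (Ω : Set (Fin n → ℂ)) (h : (Fin n → ℂ) → EReal) : Prop where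
  psup : IsPSupH Ω h
  nonneg : ∀ z ∈ Ω, 0 ≤ h z
  reg : ∀ ξ ∈ closure Ω, uscReg Ω h ξ = lscReg Ω h ξ

lemma BdryData.tendsto (H : BdryData Ω h) {ξ : Fin n → ℂ} (hξ : ξ ∈ closure Ω) :
    Tendsto h (𝓝[Ω] ξ) (𝓝 (lscReg Ω h ξ)) :=
  tendsto_of_liminf_eq_limsup rfl (H.reg ξ hξ)

lemma BdryData.lscReg_eq (H : BdryData Ω h) {z : Fin n → ℂ} (hz : z ∈ Ω) : lscReg Ω h z = h z :=
  tendsto_nhds_unique ((H.tendsto (subset_closure hz)).mono_left (pure_le_nhdsWithin hz))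
    (tendsto_pure_nhds h z)

lemma BdryData.continuousOn (H : BdryData Ω h) : ContinuousOn h Ω := fun z hz => by
  have := H.tendsto (subset_closure hz)
  rwa [H.lscReg_eq hz] at this

lemma BdryData.continuousOn_lscReg (H : BdryData Ω h) : ContinuousOn (lscReg Ω h) (closure Ω) := by
  refine (continuousOn_extendFrom (f := h) le_rfl fun ξ hξ => ⟨_, H.tendsto hξ⟩).congr
    fun ξ hξ => ?_
  have : (𝓝[Ω] ξ).NeBot := mem_closure_iff_nhdsWithin_neBot.1 hξ
  exact (extendFrom_eq hξ (H.tendsto hξ)).symm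

lemma BdryData.lscReg_nonneg (H : BdryData Ω h) {ξ : Fin n → ℂ} (hξ : ξ ∈ closure Ω) :
    0 ≤ lscReg Ω h ξ := by
  have : (𝓝[Ω] ξ).NeBot := mem_closure_iff_nhdsWithin_neBot.1 hξ
  refine ge_of_tendsto (H.tendsto hξ) ?_
  filter_upwards [self_mem_nhdsWithin] with z hz using H.nonneg z hz

lemma BdryData.posSH (H : BdryData Ω h) : PosSH Ω fun z => (h z).toENNReal :=
  H.psup.preSH.posSH H.nonneg

lemma IsPSupH.exists_ne_top (H : IsPSupH Ω h) : ∃ z ∈ Ω, h z ≠ ⊤ := by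
  obtain ⟨z, hz, hne⟩ := H.2.2.1
  exact ⟨z, hz, fun h => hne (by simp [h])⟩

lemma le_limsup_nhdsWithin {z : Fin n → ℂ} (hz : z ∈ Ω) : u z ≤ limsup u (𝓝[Ω] z) :=
  le_limsup_of_frequently_le (((frequently_pure (p := fun x => u z ≤ u x)).2 le_rfl).filter_mono
    (pure_le_nhdsWithin hz))

/-- The functions admitted in the Perron–Bremermann envelope lie below the data. -/
lemma BdryData.competitor_le (H : BdryData Ω h)
    (hu : ∀ ξ ∈ closure Ω, uscReg Ω u ξ ≤ lscReg Ω h ξ) {z : Fin n → ℂ} (hz : z ∈ Ω) :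
    u z ≤ h z :=
  (le_limsup_nhdsWithin hz).trans ((hu z (subset_closure hz)).trans (H.lscReg_eq hz).le)

lemma BdryData.perron_le (H : BdryData Ω h) {z : Fin n → ℂ} (hz : z ∈ Ω) : Perron Ω h z ≤ h z := by
  refine sSup_le ?_
  rintro y ⟨u, -, hu, rfl⟩
  exact H.competitor_le hu hz

lemma BdryData.le_perron (H : BdryData Ω h) (hΩ : IsOpen Ω) (hu : PreSH Ω u)
    (hle : ∀ z ∈ Ω, u z ≤ h z) {z : Fin n → ℂ} (hz : z ∈ Ω) : u z ≤ Perron Ω h z := by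
  by_cases hb : u z = ⊥
  · rw [hb]; exact bot_le
  · refine le_sSup ⟨u, hu.isPSH hΩ ⟨z, hz, hb⟩, fun ξ hξ => ?_, rfl⟩
    rw [← H.reg ξ hξ]
    exact limsup_le_limsup (by filter_upwards [self_mem_nhdsWithin] with x hx using hle x hx)

lemma BdryData.perron_nonneg (H : BdryData Ω h) (hΩ : IsOpen Ω) {z : Fin n → ℂ} (hz : z ∈ Ω) :
    0 ≤ Perron Ω h z := by
  simpa using H.le_perron hΩ (PreSH.const Ω 0) (by simpa using H.nonneg) hz

lemma BdryData.perron_le_real (H : BdryData Ω h) (hΩ : IsOpen Ω) (hc : IsPreconnected Ω)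
    {z₀ : Fin n → ℂ} (hz₀ : z₀ ∈ Ω) : ∃ M : ℝ, ∀ᶠ z in 𝓝 z₀, Perron Ω h z ≤ M := by
  obtain ⟨a, ha, hfa⟩ := H.psup.exists_ne_top
  obtain ⟨R, hR, hRΩ, hfin⟩ := H.posSH.exists_lintegral_ball_lt_top hΩ hc ⟨a, ha, fun h => hfa (by
    simpa using h)⟩ hz₀
  set I := ∫⁻ y in Metric.ball z₀ R, (h y).toENNReal with hI
  set c := volume (Metric.ball z₀ (R / 4)) with hcdef
  have hc0 : c ≠ 0 := (Metric.measure_ball_pos volume z₀ (by positivity)).ne'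
  have hdiv : I / c ≠ ⊤ := ENNReal.div_ne_top hfin.ne hc0
  refine ⟨(I / c).toReal, ?_⟩
  filter_upwards [Metric.ball_mem_nhds z₀ (show 0 < R / 2 by positivity)] with z hz
  rw [Metric.mem_ball] at hz
  have hsub : Metric.closedBall z (R / 4) ⊆ Metric.ball z₀ R := fun y hy => by
    rw [Metric.mem_closedBall] at hy
    rw [Metric.mem_ball]
    linarith [dist_triangle y z z₀]
  have hsub' : Metric.ball z (R / 4) ⊆ Metric.ball z₀ R := Metric.ball_subset_closedBall.trans hsub
  refine sSup_le ?_
  rintro y ⟨u, hu, hule, rfl⟩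
  have hw : PreSH Ω fun z => max (u z) ((0 : ℝ) : EReal) := hu.preSH.sup (PreSH.const _ 0)
  obtain ⟨M, hM⟩ := hw.exists_le_on_compact (isCompact_closedBall z (R / 4)) (hsub.trans hRΩ)
  have h1 := (hw.mono (hsub'.trans hRΩ)).mean_le (fun z _ => le_max_right _ _)
    (fun z hz => hM z (Metric.ball_subset_closedBall hz)) (by positivity)
  have h2 : ∫⁻ y in Metric.ball z (R / 4), (max (u y) ((0 : ℝ) : EReal)).toENNReal ≤ I := by
    refine le_trans (setLIntegral_mono' Metric.isOpen_ball.measurableSet fun y hy => ?_)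
      (lintegral_mono_set hsub')
    exact EReal.toENNReal_le_toENNReal
      (max_le (H.competitor_le hule (hRΩ (hsub' hy))) (H.nonneg _ (hRΩ (hsub' hy))))
  rw [Measure.addHaar_ball_center, ← Measure.addHaar_ball_center volume z₀, ← hcdef] at h1
  have h3 : (max (u z) ((0 : ℝ) : EReal)).toENNReal ≤ I / c := by
    rw [ENNReal.le_div_iff_mul_le (Or.inl hc0) (Or.inr hfin.ne), mul_comm]
    exact h1.trans h2
  refine (le_max_left _ ((0 : ℝ) : EReal)).trans ?_
  rw [← EReal.coe_toENNReal (le_max_right (u z) ((0 : ℝ) : EReal)),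
    EReal.coe_ennreal_toReal hdiv]
  exact EReal.coe_ennreal_le_coe_ennreal_iff.2 h3

lemma limsup_nhds_lt_eventually {y : EReal} {a : Fin n → ℂ} (h : limsup u (𝓝 a) < y) :
    ∀ᶠ b in 𝓝 a, limsup u (𝓝 b) < y := by
  obtain ⟨c, hc1, hc2⟩ := exists_between h
  filter_upwards [eventually_eventually_nhds.2 (eventually_lt_of_limsup_lt hc1)] with b hb
  exact (limsup_le_of_le (h := hb.mono fun _ hx => hx.le)).trans_lt hc2

lemma BdryData.perron_preSH (H : BdryData Ω h) (hΩ : IsOpen Ω) (hc : IsPreconnected Ω) :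
    PreSH Ω (Perron Ω h) := by
  have hbd := fun z hz => H.perron_le_real hΩ hc (z₀ := z) hz
  set Q : (Fin n → ℂ) → EReal := fun z => limsup (Perron Ω h) (𝓝 z) with hQ
  have hPQ : ∀ z ∈ Ω, Perron Ω h z ≤ Q z := fun z hz => by
    have := le_limsup_nhdsWithin (u := Perron Ω h) hz
    rwa [hΩ.nhdsWithin_eq hz] at this
  have hpre : PreSH Ω Q := by
    refine ⟨fun z hz y hy => (limsup_nhds_lt_eventually hy).filter_mono nhdsWithin_le_nhds,
      fun z hz => ?_, fun z hz w hw p hp => ?_⟩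
    · obtain ⟨M, hM⟩ := hbd z hz
      exact ((limsup_le_of_le (h := hM)).trans_lt (EReal.coe_lt_top M)).ne
    · refine ereal_le_coe_of_forall_pos fun ε hε => ?_
      have h1 : ∀ᶠ y in 𝓝 z, ∀ ζ ∈ Metric.sphere (0 : ℂ) 1,
          Perron Ω h (y + ζ • w) ≤ (((p + C (ε : ℂ)).eval ζ).re : ℝ) := by
        refine (isCompact_sphere (0 : ℂ) 1).eventually_forall_of_forall_eventually
          fun ζ₀ hζ₀ => ?_
        have hlt : Q (z + ζ₀ • w) < (((p.eval ζ₀).re + ε / 2 : ℝ) : EReal) :=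
          (hp ζ₀ (by simpa using hζ₀)).trans_lt (EReal.coe_lt_coe_iff.2 (by linarith))
        have hcont : Continuous fun x : (Fin n → ℂ) × ℂ => x.1 + x.2 • w := by fun_prop
        have hcont2 : Continuous fun x : (Fin n → ℂ) × ℂ => (p.eval x.2).re :=
          Complex.continuous_re.comp (p.continuous.comp continuous_snd)
        filter_upwards [(hcont.tendsto (z, ζ₀)).eventually (eventually_lt_of_limsup_lt hlt),
          (hcont2.tendsto (z, ζ₀)).eventually
            (lt_mem_nhds (show (p.eval ζ₀).re - ε / 2 < (p.eval ζ₀).re by linarith))] with x hx hx2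
        refine hx.le.trans (EReal.coe_le_coe_iff.2 ?_)
        simp only [eval_add, eval_C, add_re, ofReal_re]
        linarith
      have h2 : ∀ᶠ y in 𝓝 z, ∀ ζ ∈ Metric.closedBall (0 : ℂ) 1, y + ζ • w ∈ Ω := by
        refine (isCompact_closedBall (0 : ℂ) 1).eventually_forall_of_forall_eventually
          fun ζ₀ hζ₀ => ?_
        have hcont : Continuous fun x : (Fin n → ℂ) × ℂ => x.1 + x.2 • w := by fun_prop
        exact (hcont.tendsto (z, ζ₀)).eventually
          (hΩ.mem_nhds (hw ζ₀ (by simpa using hζ₀)))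
      refine limsup_le_of_le (h := ?_)
      filter_upwards [h1, h2, hΩ.mem_nhds hz] with y hy1 hy2 hyΩ
      refine sSup_le ?_
      rintro _ ⟨u, hu, hule, rfl⟩
      have := hu.preSH.center y hyΩ w (fun ζ hζ => hy2 ζ (by simpa using hζ)) (p + C (ε : ℂ))
        fun ζ hζ => (show u _ ≤ Perron Ω h _ from le_sSup ⟨u, hu, hule, rfl⟩).trans
          (hy1 ζ (by simpa using hζ))
      simpa using this
  refine hpre.congr fun z hz => le_antisymm (hPQ z hz) (H.le_perron hΩ hpre (fun z hz => ?_) hz)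
  have hz' : 𝓝[Ω] z = 𝓝 z := hΩ.nhdsWithin_eq hz
  have ht := H.continuousOn z hz
  rw [ContinuousWithinAt, hz'] at ht
  replace ht := ht.limsup_eq
  rw [← ht]
  exact limsup_le_limsup (by filter_upwards [hΩ.mem_nhds hz] with x hx using H.perron_le hx)

end

/-! ### Boundary values and continuity of envelopes of bounded data -/

section

variable {n : ℕ} {Ω : Set (Fin n → ℂ)} {g h : (Fin n → ℂ) → EReal}

lemma BdryData.of_tendsto (hΩ : IsOpen Ω) (hs : PreSH Ω fun z => -h z)
    (hne : ∃ z ∈ Ω, h z ≠ ⊤) (h0 : ∀ z ∈ Ω, 0 ≤ h z)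
    (ht : ∀ ξ ∈ closure Ω, ∃ L, Tendsto h (𝓝[Ω] ξ) (𝓝 L)) : BdryData Ω h := by
  refine ⟨hs.isPSH hΩ ?_, h0, fun ξ hξ => ?_⟩
  · obtain ⟨z, hz, hzt⟩ := hne
    exact ⟨z, hz, by simpa using hzt⟩
  · have : (𝓝[Ω] ξ).NeBot := mem_closure_iff_nhdsWithin_neBot.1 hξ
    obtain ⟨L, hL⟩ := ht ξ hξ
    exact hL.limsup_eq.trans hL.liminf_eq.symm

lemma BdryData.min_const (H : BdryData Ω g) (hΩ : IsOpen Ω) {k : ℝ} (hk : 0 ≤ k) :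
    BdryData Ω fun z => min (g z) (k : EReal) := by
  refine BdryData.of_tendsto hΩ ?_ ?_ (fun z hz => le_min (H.nonneg z hz) (by exact_mod_cast hk))
    fun ξ hξ => ⟨_, (H.tendsto hξ).min tendsto_const_nhds⟩
  · refine (H.psup.preSH.sup (PreSH.const Ω (-k))).congr fun z _ => ?_
    simp only
    rw [EReal.coe_neg]
    exact (EReal.neg_strictAnti.antitone).map_min
  · obtain ⟨z, hz, hzt⟩ := H.psup.exists_ne_top
    exact ⟨z, hz, ((min_le_right _ _).trans_lt (EReal.coe_lt_top k)).ne⟩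

lemma BdryData.lscReg_min_const (H : BdryData Ω g) {k : ℝ} {ξ : Fin n → ℂ} (hξ : ξ ∈ closure Ω) :
    lscReg Ω (fun z => min (g z) (k : EReal)) ξ = min (lscReg Ω g ξ) k := by
  have : (𝓝[Ω] ξ).NeBot := mem_closure_iff_nhdsWithin_neBot.1 hξ
  exact ((H.tendsto hξ).min tendsto_const_nhds).liminf_eq

lemma BdryData.perron_mono (H : BdryData Ω h) (G : BdryData Ω g) (hΩ : IsOpen Ω)
    (hc : IsPreconnected Ω) (hle : ∀ z ∈ Ω, h z ≤ g z) {z : Fin n → ℂ} (hz : z ∈ Ω) :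
    Perron Ω h z ≤ Perron Ω g z :=
  G.le_perron hΩ (H.perron_preSH hΩ hc) (fun z hz => (H.perron_le hz).trans (hle z hz)) hz

/-- For bounded data there is a plurisubharmonic function below the data, continuous up to the
boundary, with the same boundary values. -/
lemma BdryData.exists_subsolution (H : BdryData Ω h) (hΩ : IsOpen Ω)
    (hb : Bornology.IsBounded Ω) (hreg : BRegular Ω) (i : Fin n) {k : ℝ} (hk : ∀ z ∈ Ω, h z ≤ k) :
    ∃ F u : (Fin n → ℂ) → ℝ, (∀ ξ ∈ closure Ω, ((F ξ : ℝ) : EReal) = lscReg Ω h ξ) ∧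
      ContinuousOn F (closure Ω) ∧ ContinuousOn u (closure Ω) ∧ (∀ ξ ∈ frontier Ω, u ξ = F ξ) ∧
      PreSH Ω (fun z => (u z : EReal)) ∧ ∀ z ∈ Ω, (u z : EReal) ≤ h z := by
  have hk' : ∀ ξ ∈ closure Ω, lscReg Ω h ξ ≤ k := fun ξ hξ => by
    have : (𝓝[Ω] ξ).NeBot := mem_closure_iff_nhdsWithin_neBot.1 hξ
    refine le_of_tendsto (H.tendsto hξ) ?_
    filter_upwards [self_mem_nhdsWithin] with z hz using hk z hz
  set F : (Fin n → ℂ) → ℝ := fun ξ => (lscReg Ω h ξ).toReal with hF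
  have htop : ∀ ξ ∈ closure Ω, lscReg Ω h ξ ≠ ⊤ := fun ξ hξ =>
    ((hk' ξ hξ).trans_lt (EReal.coe_lt_top k)).ne
  have hbot : ∀ ξ ∈ closure Ω, lscReg Ω h ξ ≠ ⊥ := fun ξ hξ =>
    (bot_lt_iff_ne_bot.1 (EReal.bot_lt_zero.trans_le (H.lscReg_nonneg hξ)))
  have hFe : ∀ ξ ∈ closure Ω, ((F ξ : ℝ) : EReal) = lscReg Ω h ξ := fun ξ hξ =>
    EReal.coe_toReal (htop ξ hξ) (hbot ξ hξ)
  have hFc : ContinuousOn F (closure Ω) := fun ξ hξ =>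
    (EReal.tendsto_toReal (htop ξ hξ) (hbot ξ hξ)).comp (H.continuousOn_lscReg ξ hξ)
  obtain ⟨u, hu, huc, huF⟩ := hreg F (hFc.mono frontier_subset_closure)
  have hFh : ∀ z ∈ Ω, ((F z : ℝ) : EReal) = h z := fun z hz => by
    rw [hFe z (subset_closure hz), H.lscReg_eq hz]
  refine ⟨F, u, hFe, hFc, huc, huF, hu.preSH, fun z hz => ?_⟩
  rw [← hFh z hz]
  refine ereal_le_coe_of_forall_pos fun δ hδ => ?_
  set K := closure Ω ∩ {ξ | F ξ ≤ u ξ - δ} with hK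
  have hKc : IsCompact K := by
    refine Metric.isCompact_of_isClosed_isBounded ?_ (hb.closure.subset inter_subset_left)
    exact isClosed_closure.isClosed_le hFc (huc.sub continuousOn_const)
  have hKΩ : K ⊆ Ω := by
    rintro ξ ⟨hξ, hle⟩
    by_contra hn
    have : ξ ∈ frontier Ω := by
      rw [hΩ.frontier_eq]; exact ⟨hξ, hn⟩
    rw [mem_ofPred_eq, huF ξ this] at hle
    linarith
  have hw : PreSH Ω fun z => (u z : EReal) + -h z + ((-δ : ℝ) : EReal) :=
    (hu.preSH.add H.psup.preSH).add_const _
  have hval : ∀ z ∈ Ω, (u z : EReal) + -h z + ((-δ : ℝ) : EReal) = ((u z - F z - δ : ℝ) : EReal) :=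
    fun z hz => by
      rw [← hFh z hz, ← EReal.coe_neg, ← EReal.coe_add, ← EReal.coe_add]
      congr 1
  have := hw.nonpos_of_nonpos_off_compact hΩ hb i hKc hKΩ (fun z hz => by
    rw [hval z hz.1, ← EReal.coe_zero, EReal.coe_le_coe_iff]
    have : ¬ F z ≤ u z - δ := fun h => hz.2 ⟨subset_closure hz.1, h⟩
    linarith) z hz
  rw [hval z hz, ← EReal.coe_zero, EReal.coe_le_coe_iff] at this
  rw [EReal.coe_le_coe_iff]
  linarith

lemma BdryData.tendsto_perron_of_bounded (H : BdryData Ω h) (hΩ : IsOpen Ω)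
    (hb : Bornology.IsBounded Ω) (hreg : BRegular Ω) (i : Fin n) {k : ℝ} (hk : ∀ z ∈ Ω, h z ≤ k)
    {ξ : Fin n → ℂ} (hξ : ξ ∈ frontier Ω) :
    Tendsto (Perron Ω h) (𝓝[Ω] ξ) (𝓝 (lscReg Ω h ξ)) := by
  obtain ⟨F, u, hFe, -, huc, huF, hu, hle⟩ := H.exists_subsolution hΩ hb hreg i hk
  have hξ' := frontier_subset_closure hξ
  refine tendsto_of_tendsto_of_tendsto_of_le_of_le' (g := fun z => (u z : EReal)) ?_
    (H.tendsto hξ') ?_ ?_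
  · rw [← hFe ξ hξ', ← huF ξ hξ]
    exact (continuous_coe_real_ereal.tendsto _).comp ((huc ξ hξ').mono subset_closure)
  · filter_upwards [self_mem_nhdsWithin] with z hz using H.le_perron hΩ hu hle hz
  · filter_upwards [self_mem_nhdsWithin] with z hz using H.perron_le hz

/-- The envelope attains the boundary values of the data. -/
lemma BdryData.tendsto_perron (H : BdryData Ω h) (hΩ : IsOpen Ω) (hc : IsPreconnected Ω)
    (hb : Bornology.IsBounded Ω) (hreg : BRegular Ω) (i : Fin n) {ξ : Fin n → ℂ}
    (hξ : ξ ∈ frontier Ω) :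
    Tendsto (Perron Ω h) (𝓝[Ω] ξ) (𝓝 (lscReg Ω h ξ)) := by
  have hξ' := frontier_subset_closure hξ
  refine tendsto_order.2 ⟨fun a ha => ?_, fun a ha => ?_⟩
  · obtain ⟨b, hab, hbL⟩ := EReal.lt_iff_exists_real_btwn.1 ha
    have hk : (0 : ℝ) ≤ max b 0 := le_max_right _ _
    have H' := H.min_const hΩ hk
    have ht := H'.tendsto_perron_of_bounded hΩ hb hreg i (fun z _ => min_le_right _ _) hξ
    rw [H.lscReg_min_const hξ'] at ht
    have hlt : a < min (lscReg Ω h ξ) ((max b 0 : ℝ) : EReal) :=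
      lt_min ha (hab.trans_le (EReal.coe_le_coe_iff.2 (le_max_left _ _)))
    filter_upwards [ht.eventually_const_lt hlt, self_mem_nhdsWithin] with z hz hzΩ
    exact hz.trans_le (H'.perron_mono H hΩ hc (fun _ _ => min_le_left _ _) hzΩ)
  · filter_upwards [(H.tendsto hξ').eventually_lt_const ha, self_mem_nhdsWithin] with z hz hzΩ
    exact (H.perron_le hzΩ).trans_lt hz

/-- Envelopes of bounded data are lower semicontinuous. -/
lemma BdryData.perron_lsc_of_bounded (H : BdryData Ω h) (hΩ : IsOpen Ω) (hc : IsPreconnected Ω)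
    (hb : Bornology.IsBounded Ω) (hreg : BRegular Ω) (i : Fin n) {k : ℝ} (hk : ∀ z ∈ Ω, h z ≤ k) :
    LowerSemicontinuousOn (Perron Ω h) Ω := by
  obtain ⟨F, u, hFe, hFc, huc, huF, hu, hle⟩ := H.exists_subsolution hΩ hb hreg i hk
  have hP := H.perron_preSH hΩ hc
  have hFh : ∀ z ∈ Ω, h z = ((F z : ℝ) : EReal) := fun z hz => by
    rw [hFe z (subset_closure hz), H.lscReg_eq hz]
  have hcl : IsCompact (closure Ω) :=
    Metric.isCompact_of_isClosed_isBounded isClosed_closure hb.closure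
  have key : ∀ ε : ℝ, 0 < ε → ∃ δ > 0, ∀ y : Fin n → ℂ, ‖y‖ < δ → ∀ a ∈ Ω, a + y ∈ Ω →
      Perron Ω h (a + y) + ((-(2 * ε) : ℝ) : EReal) ≤ Perron Ω h a := by
    intro ε hε
    obtain ⟨δ₁, hδ₁, hunif⟩ := Metric.uniformContinuousOn_iff.1
      (hcl.uniformContinuousOn_of_continuous hFc) ε hε
    set K := closure Ω ∩ {ξ | u ξ ≤ F ξ - ε} with hK
    have hKc : IsCompact K := by
      refine Metric.isCompact_of_isClosed_isBounded ?_ (hb.closure.subset inter_subset_left)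
      exact isClosed_closure.isClosed_le huc (hFc.sub continuousOn_const)
    have hKΩ : K ⊆ Ω := by
      rintro ξ ⟨hξ, hle⟩
      by_contra hn
      have : ξ ∈ frontier Ω := by
        rw [hΩ.frontier_eq]; exact ⟨hξ, hn⟩
      rw [mem_ofPred_eq, huF ξ this] at hle
      linarith
    obtain ⟨δ₂, hδ₂, hthick⟩ := hKc.exists_thickening_subset_open hΩ hKΩ
    refine ⟨min δ₁ δ₂, lt_min hδ₁ hδ₂, fun y hy => ?_⟩
    have hnear : ∀ a ∈ Ω, a + y ∈ Ω → F (a + y) < F a + ε := fun a ha hay => by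
      have := hunif (a + y) (subset_closure hay) a (subset_closure ha) (by
        rw [dist_eq_norm, add_sub_cancel_left]
        exact hy.trans_le (min_le_left _ _))
      rw [Real.dist_eq] at this
      linarith [(abs_lt.1 this).2]
    have hPF : ∀ a ∈ Ω, a + y ∈ Ω →
        Perron Ω h (a + y) + ((-(2 * ε) : ℝ) : EReal) ≤ ((F a - ε : ℝ) : EReal) := by
      intro a ha hay
      have h1 := H.perron_le hay
      rw [hFh _ hay] at h1
      rw [ereal_add_coe_le_iff]
      refine h1.trans (EReal.coe_le_coe_iff.2 ?_)
      linarith [hnear a ha hay]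
    classical
    set T : (Fin n → ℂ) → EReal := fun a => if a + y ∈ Ω then
      max (Perron Ω h a) (Perron Ω h (a + y) + ((-(2 * ε) : ℝ) : EReal)) else Perron Ω h a with hT
    have hTp : PreSH Ω T := by
      refine PreSH.of_local fun a ha => ?_
      by_cases hay : a + y ∈ Ω
      · refine ⟨Ω ∩ (fun z => z + y) ⁻¹' Ω, hΩ.inter (hΩ.preimage (continuous_add_const y)),
          ⟨ha, hay⟩, ?_⟩
        refine ((hP.mono inter_subset_left).sup
          (((hP.translate y).mono inter_subset_right).add_const (-(2 * ε)))).congr fun b hb => ?_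
        simp only [hT]
        exact if_pos hb.2
      · refine ⟨Ω \ K, hΩ.sdiff hKc.isClosed, ⟨ha, fun haK => hay (hthick ?_)⟩,
          (hP.mono sdiff_subset).congr fun b hb => ?_⟩
        · refine Metric.mem_thickening_iff.2 ⟨a, haK, ?_⟩
          rw [dist_eq_norm, add_sub_cancel_left]
          exact hy.trans_le (min_le_right _ _)
        · simp only [hT]
          split_ifs with hby
          · refine max_eq_left ((hPF b hb.1 hby).trans ?_)
            refine le_trans (EReal.coe_le_coe_iff.2 ?_) (H.le_perron hΩ hu hle hb.1)
            by_contra! hcon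
            exact hb.2 ⟨subset_closure hb.1, hcon.le⟩
          · rfl
    have hTh : ∀ a ∈ Ω, T a ≤ h a := fun a ha => by
      simp only [hT]
      split_ifs with hay
      · refine max_le (H.perron_le ha) ((hPF a ha hay).trans ?_)
        rw [hFh a ha, EReal.coe_le_coe_iff]
        linarith
      · exact H.perron_le ha
    intro a ha hay
    have := H.le_perron hΩ hTp hTh ha
    simp only [hT, if_pos hay] at this
    exact (le_max_right _ _).trans this
  intro z hz c hc'
  obtain ⟨d, hcd, hdP⟩ := EReal.lt_iff_exists_real_btwn.1 hc'
  obtain ⟨c', hcc', hc'd⟩ := EReal.lt_iff_exists_real_btwn.1 hcd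
  rw [EReal.coe_lt_coe_iff] at hc'd
  obtain ⟨δ, hδ, hkey⟩ := key ((d - c') / 2) (by linarith)
  filter_upwards [nhdsWithin_le_nhds (Metric.ball_mem_nhds z hδ), self_mem_nhdsWithin]
    with a ha haΩ
  have h1 := hkey (z - a) (by rwa [← dist_eq_norm, dist_comm]) a haΩ (by simpa using hz)
  rw [add_sub_cancel] at h1
  refine hcc'.trans (lt_of_lt_of_le ?_ h1)
  rw [ereal_lt_add_coe_iff]
  refine lt_of_le_of_lt (EReal.coe_le_coe_iff.2 ?_) hdP
  linarith

end

/-! ### Tame data -/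

section

variable {n : ℕ} {Ω U : Set (Fin n → ℂ)} {g : (Fin n → ℂ) → EReal}
  {f : ℕ → (Fin n → ℂ) → ENNReal}

lemma Tame.exists_lt (ht : Tame Ω g) (hU : IsOpen U) (hUΩ : U ⊆ Ω) (hne : U.Nonempty)
    {ε : EReal} (hε : 0 < ε) :
    ∃ lam : ℝ, 0 ≤ lam ∧ ∃ ζ ∈ U, ∃ v, IsPSupH Ω v ∧
      (∀ z ∈ Ω, max (g z - (lam : EReal)) 0 ≤ v z) ∧ v ζ < ε := by
  obtain ⟨z, hz⟩ := hne
  have h1 : Sop Ω g z < ε := by rwa [ht z (hUΩ hz)]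
  obtain ⟨z₁, hz₁, hz₁U⟩ := ((frequently_lt_of_liminf_lt (h := h1)).and_eventually
    (nhdsWithin_le_nhds (hU.mem_nhds hz))).exists
  obtain ⟨lam, hlam⟩ := iInf_lt_iff.1 hz₁
  obtain ⟨hlam0, hlt⟩ := iInf_lt_iff.1 hlam
  obtain ⟨z₂, hz₂, hz₂U⟩ := ((frequently_lt_of_liminf_lt (h := hlt)).and_eventually
    (nhdsWithin_le_nhds (hU.mem_nhds hz₁U))).exists
  obtain ⟨_, ⟨v, hv, hle, rfl⟩, hvlt⟩ := sInf_lt_iff.1 hz₂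
  exact ⟨lam, hlam0, z₂, hz₂U, v, hv, hle, hvlt⟩

/-- Tame functions are dominated, above suitable levels, by a summable sequence of
plurisuperharmonic functions. -/
lemma Tame.exists_summable (ht : Tame Ω g) (hΩ : IsOpen Ω) (hne : Ω.Nonempty) :
    ∃ (f : ℕ → (Fin n → ℂ) → ENNReal) (lam : ℕ → ℝ), (∀ j, PosSH Ω (f j)) ∧ (∀ j, 0 ≤ lam j) ∧
      (∀ j, ∀ z ∈ Ω, g z ≤ (f j z : EReal) + (lam j : EReal)) ∧ ∃ z ∈ Ω, ∑' j, f j z ≠ ⊤ := by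
  obtain ⟨a, ha⟩ := hne
  obtain ⟨r, hr, hrΩ⟩ := Metric.isOpen_iff.1 hΩ a ha
  have hr3 : 0 < r / 3 := by positivity
  have hex := fun j : ℕ => ht.exists_lt (U := Metric.ball a (r / 3)) Metric.isOpen_ball
    ((Metric.ball_subset_ball (by linarith)).trans hrΩ) ⟨a, Metric.mem_ball_self hr3⟩
    (ε := (((2⁻¹ : ENNReal) ^ j : ENNReal) : EReal)) (by
      rw [← EReal.coe_ennreal_zero, EReal.coe_ennreal_lt_coe_ennreal_iff]
      exact ENNReal.pow_pos (by simp) _)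
  choose lam hlam ζ hζ v hv hgv hlt using hex
  have hv0 : ∀ j, ∀ z ∈ Ω, 0 ≤ v j z := fun j z hz => (le_max_right _ _).trans (hgv j z hz)
  set f : ℕ → (Fin n → ℂ) → ENNReal := fun j z => (v j z).toENNReal with hf
  have hfp : ∀ j, PosSH Ω (f j) := fun j => (hv j).preSH.posSH (hv0 j)
  have h_integ : ∀ j, ∫⁻ z in Metric.ball a (r / 3), f j z ≤
      volume (Metric.ball a (2 * r / 3)) * (2⁻¹ : ENNReal) ^ j := fun j => by
    have hd : dist (ζ j) a < r / 3 := hζ j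
    have h1 : Metric.ball a (r / 3) ⊆ Metric.ball (ζ j) (2 * r / 3) :=
      Metric.ball_subset_ball' (by rw [dist_comm]; linarith)
    have h2 : Metric.ball (ζ j) (2 * r / 3) ⊆ Ω :=
      (Metric.ball_subset_ball' (by linarith)).trans hrΩ
    refine (lintegral_mono_set h1).trans ((((hfp j).mono h2).lintegral_ball_le).trans ?_)
    rw [Measure.addHaar_ball_center, ← Measure.addHaar_ball_center volume a]
    gcongr
    rw [← EReal.coe_ennreal_le_coe_ennreal_iff, hf]
    simp only
    rw [EReal.coe_toENNReal (hv0 j _ (h2 (Metric.mem_ball_self (by positivity))))]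
    exact (hlt j).le
  refine ⟨f, lam, hfp, hlam, fun j z hz => ?_, ?_⟩
  · rw [hf]
    simp only
    rw [EReal.coe_toENNReal (hv0 j z hz), ← EReal.sub_le_iff_le_add (Or.inl (EReal.coe_ne_bot _))
      (Or.inl (EReal.coe_ne_top _))]
    exact (le_max_left _ _).trans (hgv j z hz)
  · have hsub : Metric.ball a (r / 3) ⊆ Ω := (Metric.ball_subset_ball (by linarith)).trans hrΩ
    have htot : ∫⁻ z in Metric.ball a (r / 3), ∑' j, f j z ≠ ⊤ := by
      rw [lintegral_tsum fun j => ((hfp j).mono hsub).aemeasurable Metric.isOpen_ball]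
      refine ne_top_of_le_ne_top ?_ (ENNReal.tsum_le_tsum h_integ)
      rw [ENNReal.tsum_mul_left, ENNReal.tsum_geometric]
      exact ENNReal.mul_ne_top measure_ball_lt_top.ne (by simp)
    by_contra! h
    rw [setLIntegral_congr_fun Metric.isOpen_ball.measurableSet fun z hz => h z (hsub hz),
      setLIntegral_const, ENNReal.top_mul (Metric.measure_ball_pos _ _ hr3).ne'] at htot
    exact htot rfl

lemma BdryData.perron_sub_le (H : BdryData Ω g) (hΩ : IsOpen Ω) (hc : IsPreconnected Ω)
    {f : (Fin n → ℂ) → ENNReal} (hf : PosSH Ω f) {lam : ℝ} (hlam : 0 ≤ lam)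
    (hle : ∀ z ∈ Ω, g z ≤ (f z : EReal) + (lam : EReal)) {z : Fin n → ℂ} (hz : z ∈ Ω) :
    Perron Ω g z + -(f z : EReal) ≤ Perron Ω (fun z => min (g z) (lam : EReal)) z := by
  refine (H.min_const hΩ hlam).le_perron hΩ ((H.perron_preSH hΩ hc).add hf.preSH)
    (fun z hz => le_min ?_ ?_) hz
  · refine le_trans ?_ (H.perron_le hz)
    refine (add_le_add_right ?_ (Perron Ω g z)).trans (add_zero _).le
    simpa using EReal.coe_ennreal_nonneg (f z)
  · rw [← sub_eq_add_neg]
    refine EReal.sub_le_of_le_add ?_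
    rw [add_comm]
    exact (H.perron_le hz).trans (hle z hz)

/-- The envelope of dominated data is continuous off the set where the dominating series
diverges. -/
lemma BdryData.continuousAt_perron (H : BdryData Ω g) (hΩ : IsOpen Ω) (hc : IsPreconnected Ω)
    (hb : Bornology.IsBounded Ω) (hreg : BRegular Ω) (i : Fin n) {lam : ℕ → ℝ}
    (hf : ∀ j, PosSH Ω (f j)) (hlam : ∀ j, 0 ≤ lam j)
    (hle : ∀ j, ∀ z ∈ Ω, g z ≤ (f j z : EReal) + (lam j : EReal)) {z : Fin n → ℂ} (hz : z ∈ Ω)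
    (hsum : ∑' j, f j z ≠ ⊤) : ContinuousAt (Perron Ω g) z := by
  have hP := H.perron_preSH hΩ hc
  refine continuousAt_iff_lower_upperSemicontinuousAt.2 ⟨fun c hc' => ?_, fun c hc' => ?_⟩
  · have hlim : Tendsto (fun j => Perron Ω g z + -(f j z : EReal)) atTop (𝓝 (Perron Ω g z)) := by
      have h1 : Tendsto (fun j => -(f j z : EReal)) atTop (𝓝 0) := by
        have := (continuous_coe_ennreal_ereal.tendsto 0).comp
          (ENNReal.tendsto_atTop_zero_of_tsum_ne_top hsum)
        simpa [Function.comp_def] using (continuous_neg.tendsto _).comp this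
      have h2 : ContinuousAt (fun p : EReal × EReal => p.1 + p.2) (Perron Ω g z, 0) :=
        EReal.continuousAt_add (by simp) (by simp)
      simpa [Function.comp_def] using h2.tendsto.comp (tendsto_const_nhds.prodMk_nhds h1)
    obtain ⟨j, hj⟩ := (hlim.eventually_const_lt hc').exists
    have hlt := hj.trans_le (H.perron_sub_le hΩ hc (hf j) (hlam j) (hle j) hz)
    have H' := H.min_const hΩ (hlam j)
    have := H'.perron_lsc_of_bounded hΩ hc hb hreg i (fun z _ => min_le_right _ _) z hz c hlt
    rw [hΩ.nhdsWithin_eq hz] at this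
    filter_upwards [this, hΩ.mem_nhds hz] with y hy hyΩ
    exact hy.trans_le (H'.perron_mono H hΩ hc (fun _ _ => min_le_left _ _) hyΩ)
  · have := hP.usc z hz c hc'
    rwa [hΩ.nhdsWithin_eq hz] at this

end

/-! ### Concave reparametrizations of the values -/

/-- A concave increasing bijection of `[0, ∞)` together with its extension to `[0, ∞]` and the
inverse of the extension. -/
structure ConcaveReparam (ψ : ℝ → ℝ) (Ψ Ψinv : EReal → EReal) : Prop where
  conc : ConcaveOn ℝ (Ici 0) ψ
  mono : StrictMonoOn ψ (Ici 0)
  bij : BijOn ψ (Ici 0) (Ici 0)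
  agree : ∀ t : ℝ, 0 ≤ t → Ψ (t : EReal) = ((ψ t : ℝ) : EReal)
  top : Ψ ⊤ = ⊤
  inv : ∀ x : EReal, 0 ≤ x → Ψinv (Ψ x) = x

namespace ConcaveReparam

variable {ψ : ℝ → ℝ} {Ψ Ψinv : EReal → EReal}

lemma zero (h : ConcaveReparam ψ Ψ Ψinv) : ψ 0 = 0 := by
  obtain ⟨t, ht, ht0⟩ := h.bij.surjOn (show (0 : ℝ) ∈ Ici 0 from self_mem_Ici)
  refine le_antisymm ?_ (h.bij.mapsTo (show (0 : ℝ) ∈ Ici 0 from self_mem_Ici))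
  exact (h.mono.monotoneOn self_mem_Ici ht ht).trans_eq ht0

lemma exists_coe {x : EReal} (hx : 0 ≤ x) (hx' : x ≠ ⊤) : ∃ t : ℝ, 0 ≤ t ∧ (t : EReal) = x := by
  lift x to ℝ using ⟨hx', fun h => by simp [h] at hx⟩
  exact ⟨x, by exact_mod_cast hx, rfl⟩

lemma ne_top (h : ConcaveReparam ψ Ψ Ψinv) {x : EReal} (hx : 0 ≤ x) (hx' : x ≠ ⊤) : Ψ x ≠ ⊤ := by
  obtain ⟨t, ht, rfl⟩ := exists_coe hx hx'
  rw [h.agree t ht]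
  exact EReal.coe_ne_top _

lemma nonneg (h : ConcaveReparam ψ Ψ Ψinv) {x : EReal} (hx : 0 ≤ x) : 0 ≤ Ψ x := by
  by_cases hx' : x = ⊤
  · simp [hx', h.top]
  · obtain ⟨t, ht, rfl⟩ := exists_coe hx hx'
    rw [h.agree t ht]
    exact_mod_cast h.bij.mapsTo ht

lemma strictMonoOn (h : ConcaveReparam ψ Ψ Ψinv) : StrictMonoOn Ψ (Ici 0) := by
  intro x hx y hy hxy
  obtain ⟨t, ht, rfl⟩ := exists_coe hx (hxy.trans_le le_top).ne
  by_cases hy' : y = ⊤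
  · rw [hy', h.top, h.agree t ht]
    exact EReal.coe_lt_top _
  · obtain ⟨s, hs, rfl⟩ := exists_coe hy hy'
    rw [h.agree t ht, h.agree s hs, EReal.coe_lt_coe_iff]
    exact h.mono ht hs (EReal.coe_lt_coe_iff.1 hxy)

lemma exists_eq (h : ConcaveReparam ψ Ψ Ψinv) {y : EReal} (hy : 0 ≤ y) : ∃ x, 0 ≤ x ∧ Ψ x = y := by
  by_cases hy' : y = ⊤
  · exact ⟨⊤, le_top, by rw [hy', h.top]⟩
  · obtain ⟨s, hs, rfl⟩ := exists_coe hy hy'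
    obtain ⟨t, ht, rfl⟩ := h.bij.surjOn hs
    exact ⟨t, by exact_mod_cast ht, h.agree t ht⟩

lemma inv_nonneg (h : ConcaveReparam ψ Ψ Ψinv) {y : EReal} (hy : 0 ≤ y) : 0 ≤ Ψinv y := by
  obtain ⟨x, hx, rfl⟩ := h.exists_eq hy
  rwa [h.inv x hx]

lemma apply_inv (h : ConcaveReparam ψ Ψ Ψinv) {y : EReal} (hy : 0 ≤ y) : Ψ (Ψinv y) = y := by
  obtain ⟨x, hx, rfl⟩ := h.exists_eq hy
  rw [h.inv x hx]

lemma inv_lt_iff (h : ConcaveReparam ψ Ψ Ψinv) {x y : EReal} (hx : 0 ≤ x) (hy : 0 ≤ y) :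
    Ψinv y < x ↔ y < Ψ x := by
  rw [← h.strictMonoOn.lt_iff_lt (h.inv_nonneg hy) hx, h.apply_inv hy]

/-- The extension as an order isomorphism of `[0, ∞]`. -/
def orderIso (h : ConcaveReparam ψ Ψ Ψinv) : Ici (0 : EReal) ≃o Ici (0 : EReal) :=
  StrictMono.orderIsoOfSurjective (fun x => ⟨Ψ x, h.nonneg x.2⟩)
    (fun x y hxy => h.strictMonoOn x.2 y.2 hxy) fun y => by
      obtain ⟨x, hx, hxy⟩ := h.exists_eq y.2
      exact ⟨⟨x, hx⟩, Subtype.ext hxy⟩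

lemma coe_orderIso (h : ConcaveReparam ψ Ψ Ψinv) (x : Ici (0 : EReal)) :
    (h.orderIso x : EReal) = Ψ x := rfl

lemma coe_orderIso_symm (h : ConcaveReparam ψ Ψ Ψinv) (y : Ici (0 : EReal)) :
    (h.orderIso.symm y : EReal) = Ψinv y := by
  rw [← h.inv _ (h.orderIso.symm y).2, ← h.coe_orderIso, OrderIso.apply_symm_apply]

lemma continuousOn (h : ConcaveReparam ψ Ψ Ψinv) : ContinuousOn Ψ (Ici 0) :=
  continuousOn_iff_continuous_domRestrict.2 (continuous_subtype_val.comp h.orderIso.continuous)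

lemma continuousOn_inv (h : ConcaveReparam ψ Ψ Ψinv) : ContinuousOn Ψinv (Ici 0) := by
  refine continuousOn_iff_continuous_domRestrict.2
    ((continuous_subtype_val.comp h.orderIso.symm.continuous).congr fun y => ?_)
  exact h.coe_orderIso_symm y

/-- Supporting lines at positive points. -/
lemma exists_tangent (h : ConcaveReparam ψ Ψ Ψinv) {s : ℝ} (hs : 0 < s) :
    ∃ a b : ℝ, 0 < a ∧ b ≤ ψ s ∧ a * s + b = ψ s ∧ ∀ t, 0 ≤ t → ψ t ≤ a * t + b := by
  set A := Set.image (fun t => (ψ t - ψ s) / (t - s)) (Ioi s) with hA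
  have hslope : ∀ x t, 0 ≤ x → x < s → s < t →
      (ψ t - ψ s) / (t - s) ≤ (ψ s - ψ x) / (s - x) := fun x t hx hxs hst =>
    h.conc.slope_anti_adjacent hx (mem_Ici.2 (hs.le.trans hst.le)) hxs hst
  have hub : ∀ x, 0 ≤ x → x < s → (ψ s - ψ x) / (s - x) ∈ upperBounds A := by
    rintro x hx hxs _ ⟨t, ht, rfl⟩
    exact hslope x t hx hxs ht
  have hbdd : BddAbove A := ⟨_, hub 0 le_rfl hs⟩
  have hne : A.Nonempty := ⟨_, s + 1, by simp, rfl⟩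
  set a := sSup A with ha
  have ha0 : 0 < a := by
    refine lt_of_lt_of_le ?_ (le_csSup hbdd ⟨s + 1, by simp, rfl⟩)
    have := h.mono (mem_Ici.2 hs.le) (mem_Ici.2 (by linarith : (0 : ℝ) ≤ s + 1)) (by linarith)
    exact div_pos (by linarith) (by linarith)
  refine ⟨a, ψ s - a * s, ha0, ?_, by ring, fun t ht => ?_⟩
  · nlinarith
  · rcases lt_trichotomy t s with hts | rfl | hts
    · have : a ≤ (ψ s - ψ t) / (s - t) := csSup_le hne (hub t ht hts)
      rw [le_div_iff₀ (by linarith)] at this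
      linarith
    · linarith
    · have : (ψ t - ψ s) / (t - s) ≤ a := le_csSup hbdd ⟨t, hts, rfl⟩
      rw [div_le_iff₀ (by linarith)] at this
      linarith

/-- Nearly supporting lines at nonnegative points. -/
lemma exists_almost_tangent (h : ConcaveReparam ψ Ψ Ψinv) {s : ℝ} (hs : 0 ≤ s) {ε : ℝ}
    (hε : 0 < ε) :
    ∃ a b : ℝ, 0 < a ∧ a * s + b ≤ ψ s + ε ∧ ∀ t, 0 ≤ t → ψ t ≤ a * t + b := by
  rcases hs.eq_or_lt with rfl | hs
  · obtain ⟨s, hs, hse⟩ := h.bij.surjOn (mem_Ici.2 hε.le)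
    have hs0 : 0 < s := lt_of_le_of_ne hs fun h0 => by
      rw [← h0, h.zero] at hse
      linarith
    obtain ⟨a, b, ha, hb, -, hle⟩ := h.exists_tangent hs0
    exact ⟨a, b, ha, by rw [h.zero]; linarith, hle⟩
  · obtain ⟨a, b, ha, -, heq, hle⟩ := h.exists_tangent hs
    exact ⟨a, b, ha, by linarith, hle⟩

lemma coe_le_of_le (h : ConcaveReparam ψ Ψ Ψinv) {a b : ℝ} (ha : 0 < a)
    (hle : ∀ t, 0 ≤ t → ψ t ≤ a * t + b) {x : EReal} (hx : 0 ≤ x) {c : ℝ} (hc : c ≤ Ψ x) :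
    ((a⁻¹ * (c - b) : ℝ) : EReal) ≤ x := by
  by_cases hx' : x = ⊤
  · rw [hx']; exact le_top
  · obtain ⟨t, ht, rfl⟩ := exists_coe hx hx'
    rw [h.agree t ht, EReal.coe_le_coe_iff] at hc
    rw [EReal.coe_le_coe_iff, inv_mul_le_iff₀ ha]
    linarith [hle t ht]

variable {n : ℕ} {Ω : Set (Fin n → ℂ)} {φ P : (Fin n → ℂ) → EReal}

lemma tendsto_comp (h : ConcaveReparam ψ Ψ Ψinv) (H : BdryData Ω φ) {ξ : Fin n → ℂ}
    (hξ : ξ ∈ closure Ω) :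
    Tendsto (fun z => Ψ (φ z)) (𝓝[Ω] ξ) (𝓝 (Ψ (lscReg Ω φ ξ))) := by
  refine (h.continuousOn _ (H.lscReg_nonneg hξ)).tendsto.comp
    (tendsto_nhdsWithin_of_tendsto_nhds_of_eventually_within _ (H.tendsto hξ) ?_)
  filter_upwards [self_mem_nhdsWithin] with z hz using H.nonneg z hz

lemma bdryData_comp (h : ConcaveReparam ψ Ψ Ψinv) (H : BdryData Ω φ) (hΩ : IsOpen Ω) :
    BdryData Ω fun z => Ψ (φ z) := by
  have h0 : ∀ z ∈ Ω, 0 ≤ Ψ (φ z) := fun z hz => h.nonneg (H.nonneg z hz)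
  have hcont : ContinuousOn (fun z => Ψ (φ z)) Ω :=
    h.continuousOn.comp H.continuousOn fun z hz => H.nonneg z hz
  refine BdryData.of_tendsto hΩ ⟨upperSemicontinuousOn_neg hcont.lowerSemicontinuousOn,
    fun z hz => ?_, fun z hz w hw p hp => ?_⟩ ?_ h0 fun ξ hξ => ⟨_, h.tendsto_comp H hξ⟩
  · rw [Ne, EReal.neg_eq_top_iff]
    exact (EReal.bot_lt_zero.trans_le (h0 z hz)).ne'
  · by_cases htop : φ z = ⊤
    · simp [htop, h.top]
    obtain ⟨s, hs, hsz⟩ := exists_coe (H.nonneg z hz) htop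
    rw [← hsz, h.agree s hs, ← EReal.coe_neg, EReal.coe_le_coe_iff]
    refine le_of_forall_pos_le_add fun ε hε => ?_
    obtain ⟨a, b, ha, hb, hle⟩ := h.exists_almost_tangent hs hε
    have := H.psup.preSH.center z hz w hw (C ((a⁻¹ : ℝ) : ℂ) * (p + C (b : ℂ))) fun ζ hζ => by
      have h1 := hp ζ hζ
      rw [EReal.neg_le, ← EReal.coe_neg] at h1
      have h2 := h.coe_le_of_le ha hle (H.nonneg _ (hw ζ hζ.le)) h1
      rw [EReal.neg_le, ← EReal.coe_neg]
      convert h2 using 2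
      rw [eval_mul, eval_C, Complex.re_ofReal_mul]
      simp
      ring
    rw [← hsz, ← EReal.coe_neg, EReal.coe_le_coe_iff, eval_mul, eval_C, Complex.re_ofReal_mul,
      le_inv_mul_iff₀ ha] at this
    simp only [eval_add, eval_C, add_re, ofReal_re] at this
    linarith
  · obtain ⟨z, hz, hzt⟩ := H.psup.exists_ne_top
    exact ⟨z, hz, h.ne_top (H.nonneg z hz) hzt⟩

lemma inv_ne_top (h : ConcaveReparam ψ Ψ Ψinv) {y : EReal} (hy : 0 ≤ y) (hy' : y ≠ ⊤) :
    Ψinv y ≠ ⊤ := fun h1 => hy' (by rw [← h.apply_inv hy, h1, h.top])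

lemma preSH_inv_comp (h : ConcaveReparam ψ Ψ Ψinv) (hP : PreSH Ω P) (h0 : ∀ z ∈ Ω, 0 ≤ P z) :
    PreSH Ω fun z => Ψinv (P z) := by
  refine ⟨fun z hz c hc => ?_, fun z hz => h.inv_ne_top (h0 z hz) (hP.ne_top z hz),
    fun z hz w hw p hp => ?_⟩
  · have hc0 : 0 ≤ c := (h.inv_nonneg (h0 z hz)).trans hc.le
    filter_upwards [hP.usc z hz _ ((h.inv_lt_iff hc0 (h0 z hz)).1 hc), self_mem_nhdsWithin]
      with x hx hxΩ
    exact (h.inv_lt_iff hc0 (h0 x hxΩ)).2 hx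
  · obtain ⟨s, hs, hsz⟩ := exists_coe (h.inv_nonneg (h0 z hz))
      (h.inv_ne_top (h0 z hz) (hP.ne_top z hz))
    have hPz : P z = ((ψ s : ℝ) : EReal) := by rw [← h.agree s hs, hsz, h.apply_inv (h0 z hz)]
    have hp0 : ∀ ζ : ℂ, ‖ζ‖ = 1 → 0 ≤ (p.eval ζ).re := fun ζ hζ => by
      exact_mod_cast (h.inv_nonneg (h0 _ (hw ζ hζ.le))).trans (hp ζ hζ)
    rw [← hsz, EReal.coe_le_coe_iff]
    rcases hs.eq_or_lt with rfl | hs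
    · simpa using eval_zero_re_mono 0 p 0 (by simpa using hp0)
    · obtain ⟨a, b, ha, -, heq, hle⟩ := h.exists_tangent hs
      have := hP.center z hz w hw (C (a : ℂ) * p + C (b : ℂ)) fun ζ hζ => by
        have hw' := hw ζ hζ.le
        obtain ⟨t, ht, htz⟩ := exists_coe (h.inv_nonneg (h0 _ hw'))
          (h.inv_ne_top (h0 _ hw') (hP.ne_top _ hw'))
        have h1 := hp ζ hζ
        rw [← htz, EReal.coe_le_coe_iff] at h1
        rw [← h.apply_inv (h0 _ hw'), ← htz, h.agree t ht, EReal.coe_le_coe_iff, eval_add,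
          eval_mul, eval_C, eval_C, add_re, Complex.re_ofReal_mul, ofReal_re]
        nlinarith [hle t ht]
      rw [hPz, EReal.coe_le_coe_iff, eval_add, eval_mul, eval_C, eval_C, add_re,
        Complex.re_ofReal_mul, ofReal_re] at this
      nlinarith

end ConcaveReparam

/-! ### Maximality -/

section

variable {n : ℕ} {Ω K : Set (Fin n → ℂ)} {v F : (Fin n → ℂ) → EReal}
  {f : ℕ → (Fin n → ℂ) → ENNReal}

/-- A plurisubharmonic minorant off a compact set of a locally direction-independent
plurisubharmonic function, continuous off the poles of the tails of a series, is a minorant. -/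
lemma PreSH.le_of_le_off_compact_of_tsum (hv : PreSH Ω v) (hΩ : IsOpen Ω) (hc : IsPreconnected Ω)
    (hb : Bornology.IsBounded Ω) (hK : IsCompact K) (hKΩ : K ⊆ Ω) (hF : PreSH Ω F)
    (hF0 : ∀ z ∈ Ω, 0 ≤ F z) (hf : ∀ j, PosSH Ω (f j)) (hne : ∃ z ∈ Ω, ∑' j, f j z ≠ ⊤)
    (hcont : ∀ k, ∀ z ∈ Ω, ∑' j, f (j + k) z ≠ ⊤ → ContinuousAt F z)
    (hdep : ∀ z ∈ Ω, ∃ V ∈ 𝓝 z, V ⊆ Ω ∧ ∃ i : Fin n, ∀ x ∈ V, ∀ y ∈ V,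
      (∀ j : Fin n, j ≠ i → x j = y j) → F x = F y)
    (hoff : ∀ z ∈ Ω \ K, v z ≤ F z) : ∀ z ∈ Ω, v z ≤ F z := by
  have hcoe : ∀ z ∈ Ω, ((F z).toReal : EReal) = F z := fun z hz =>
    EReal.coe_toReal (hF.ne_top z hz) (EReal.bot_lt_zero.trans_le (hF0 z hz)).ne'
  have htail : ∀ k, ∀ z ∈ Ω, v z + -((∑' j, f (j + k) z : ENNReal) : EReal) ≤ F z := by
    intro k z hz
    set V : (Fin n → ℂ) → ENNReal := fun z => ∑' j, f (j + k) z with hV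
    have hVp : PosSH Ω V := PosSH.tsum fun j => hf (j + k)
    have hw : PreSH Ω fun z => v z + -(V z : EReal) := hv.add hVp.preSH
    rw [← hcoe z hz]
    refine hw.le_of_le_off_compact hΩ hb hK hKΩ (F := fun z => (F z).toReal) ?_ ?_ ?_ z hz
    · intro x hx
      have hxΩ := hKΩ hx
      by_cases hVx : V x = ⊤
      · intro c hlt
        have hbot : v x + -(V x : EReal) = ⊥ := by simp [hVx]
        have hlt' : v x + -(V x : EReal) < c := by
          rw [hbot]
          exact bot_le.trans_lt hlt
        filter_upwards [(hw.mono hKΩ).usc x hx c hlt', self_mem_nhdsWithin] with y hy hyK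
        refine lt_of_le_of_lt ?_ hy
        refine (add_le_add_right ?_ _).trans (add_zero _).le
        have : 0 ≤ (F y).toReal := EReal.toReal_nonneg (hF0 y (hKΩ hyK))
        exact_mod_cast neg_nonpos.2 this
      · have h1 : ContinuousAt (fun z => ((-(F z).toReal : ℝ) : EReal)) x := by
          refine continuous_coe_real_ereal.continuousAt.comp (ContinuousAt.neg ?_)
          exact (EReal.tendsto_toReal (hF.ne_top x hxΩ)
            (EReal.bot_lt_zero.trans_le (hF0 x hxΩ)).ne').comp (hcont k x hxΩ hVx)
        have h2 : UpperSemicontinuousWithinAt (fun z => v z + -(V z : EReal)) K x :=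
          (hw.mono hKΩ).usc x hx
        exact h2.add' h1.continuousWithinAt.upperSemicontinuousWithinAt
          (EReal.continuousAt_add (by simp) (by simp))
    · intro x hx
      obtain ⟨U, hU, -, i, hi⟩ := hdep x (hKΩ hx)
      obtain ⟨ρ₀, hρ₀, hsub⟩ := Metric.mem_nhds_iff.1 hU
      refine ⟨i, ρ₀, hρ₀, fun ρ hρ hρ' ζ hζ => ?_⟩
      have hmem : x + ζ • Pi.single i (ρ : ℂ) ∈ U := by
        refine hsub ?_
        rw [Metric.mem_ball, dist_eq_norm, add_sub_cancel_left, norm_smul, hζ, one_mul,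
          Pi.norm_single, Complex.norm_real, Real.norm_of_nonneg hρ.le]
        exact hρ'
      rw [hi _ hmem x (mem_of_mem_nhds hU) fun j hj => by simp [Pi.single_eq_of_ne hj]]
    · intro x hx
      rw [hcoe x hx.1]
      refine le_trans ((add_le_add_right ?_ _).trans (add_zero _).le) (hoff x hx)
      simpa using EReal.coe_ennreal_nonneg (V x)
  have hgood : ∀ z ∈ Ω, ∑' j, f j z ≠ ⊤ → v z ≤ F z := by
    intro z hz hzV
    have h1 : Tendsto (fun k => -((∑' j, f (j + k) z : ENNReal) : EReal)) atTop (𝓝 0) := by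
      have := (continuous_coe_ennreal_ereal.tendsto 0).comp (ENNReal.tendsto_sum_nat_add _ hzV)
      simpa [Function.comp_def] using (continuous_neg.tendsto _).comp this
    have h2 : ContinuousAt (fun p : EReal × EReal => p.1 + p.2) (v z, 0) :=
      EReal.continuousAt_add (by simp) (by simp)
    have h3 : Tendsto (fun k => v z + -((∑' j, f (j + k) z : ENNReal) : EReal)) atTop
        (𝓝 (v z)) := by
      simpa [Function.comp_def] using h2.tendsto.comp (tendsto_const_nhds.prodMk_nhds h1)
    exact le_of_tendsto h3 (Eventually.of_forall fun k => htail k z hz)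
  intro z hz
  by_contra! hlt
  obtain ⟨c, hc1, hc2⟩ := EReal.lt_iff_exists_real_btwn.1 hlt
  obtain ⟨r, hr, hrΩ, hae⟩ := (PosSH.tsum hf).ae_lt_top hΩ hc hne hz
  have husc := hF.usc z hz c hc1
  rw [hΩ.nhdsWithin_eq hz] at husc
  obtain ⟨s, hs, hsub⟩ := Metric.mem_nhds_iff.1 husc
  have hm : Metric.ball z (min r s) ⊆ Metric.ball z r := Metric.ball_subset_ball (min_le_left _ _)
  refine hc2.not_ge ((hv.mono (hm.trans hrΩ)).le_of_ae_le (lt_min hr hs) ?_)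
  filter_upwards [ae_restrict_of_ae_restrict_of_subset hm hae,
    ae_restrict_mem Metric.isOpen_ball.measurableSet] with y hy hyb
  exact (hgood y (hrΩ (hm hyb)) hy.ne).trans
    (hsub (Metric.ball_subset_ball (min_le_right _ _) hyb)).le

end

end

/-- Proposition 4.8: let `Ω ⊆ ℂⁿ` be a bounded B-regular domain and let
`φ ≥ 0` be plurisuperharmonic on `Ω` with `φ* = φ_*` on `cl(Ω)`. Assume `ψ : [0,∞) → [0,∞)`
is a continuous, concave, strictly increasing bijection (with extended-real extension `Ψ`
satisfying `Ψ(+∞) = +∞` and extended-real inverse `Ψinv`) such that `ψ∘φ` is tame and the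
Perron–Bremermann envelope `P(ψ∘φ)` locally depends on at most `n−1` of the complex
coordinates. Then `ψ⁻¹∘P(ψ∘φ)` is a maximal plurisubharmonic function on `Ω`, continuous
outside a pluripolar set, with boundary limit `φ(z₀)` at every `z₀ ∈ ∂Ω`; i.e. it solves
the generalized Dirichlet problem with boundary data `φ`. -/
theorem statement16 {n : ℕ} (Ω : Set (Fin n → ℂ))
    (hΩo : IsOpen Ω) (hΩc : IsConnected Ω) (hΩb : Bornology.IsBounded Ω)
    (hΩreg : BRegular Ω)
    (φ : (Fin n → ℂ) → EReal) (hφ : IsPSupH Ω φ) (hφ0 : ∀ z ∈ Ω, 0 ≤ φ z)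
    (hcont : ∀ ξ ∈ closure Ω, uscReg Ω φ ξ = lscReg Ω φ ξ)
    (ψ₀ : ℝ → ℝ) (hψcont : ContinuousOn ψ₀ (Ici 0)) (hψconc : ConcaveOn ℝ (Ici 0) ψ₀)
    (hψmono : StrictMonoOn ψ₀ (Ici 0)) (hψbij : BijOn ψ₀ (Ici 0) (Ici 0))
    (Ψ Ψinv : EReal → EReal)
    (hΨagree : ∀ t : ℝ, 0 ≤ t → Ψ (t : EReal) = ((ψ₀ t : ℝ) : EReal))
    (hΨtop : Ψ ⊤ = ⊤)
    (hΨinv : InvOn Ψinv Ψ {x : EReal | 0 ≤ x} {x : EReal | 0 ≤ x})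
    (hΨmaps : MapsTo Ψ {x : EReal | 0 ≤ x} {x : EReal | 0 ≤ x})
    (htame : Tame Ω (fun z => Ψ (φ z)))
    (hdep : ∀ z ∈ Ω, ∃ V ∈ nhds z, V ⊆ Ω ∧ ∃ i : Fin n,
      ∀ x ∈ V, ∀ y ∈ V, (∀ j : Fin n, j ≠ i → x j = y j) →
        Perron Ω (fun ζ => Ψ (φ ζ)) x = Perron Ω (fun ζ => Ψ (φ ζ)) y) :
    MaximalPSH Ω (fun z => Ψinv (Perron Ω (fun ζ => Ψ (φ ζ)) z)) ∧
    (∃ E : Set (Fin n → ℂ), Pluripolar Ω E ∧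
      ContinuousOn (fun z => Ψinv (Perron Ω (fun ζ => Ψ (φ ζ)) z)) (Ω \ E)) ∧
    ∀ z₀ ∈ frontier Ω,
      Tendsto (fun z => Ψinv (Perron Ω (fun ζ => Ψ (φ ζ)) z)) (nhdsWithin z₀ Ω)
        (nhds (lscReg Ω φ z₀)) := by
  have hψ : ConcaveReparam ψ₀ Ψ Ψinv :=
    ⟨hψconc, hψmono, hψbij, hΨagree, hΨtop, fun _ hx => hΨinv.1 hx⟩
  have H : BdryData Ω φ := ⟨hφ, hφ0, hcont⟩
  have G := hψ.bdryData_comp H hΩo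
  have hc := hΩc.isPreconnected
  obtain ⟨a, ha⟩ := hΩc.nonempty
  obtain ⟨-, -, -, i, -⟩ := hdep a ha
  obtain ⟨f, lam, hf, hlam, hle, hne⟩ := htame.exists_summable hΩo hΩc.nonempty
  have hP0 : ∀ z ∈ Ω, 0 ≤ Perron Ω (fun ζ => Ψ (φ ζ)) z := fun z hz => G.perron_nonneg hΩo hz
  have hF := hψ.preSH_inv_comp (G.perron_preSH hΩo hc) hP0
  have hF0 : ∀ z ∈ Ω, 0 ≤ Ψinv (Perron Ω (fun ζ => Ψ (φ ζ)) z) := fun z hz =>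
    hψ.inv_nonneg (hP0 z hz)
  have hcontF : ∀ k, ∀ z ∈ Ω, ∑' j, f (j + k) z ≠ ⊤ →
      ContinuousAt (fun z => Ψinv (Perron Ω (fun ζ => Ψ (φ ζ)) z)) z := by
    intro k z hz hsum
    have hcP := G.continuousAt_perron hΩo hc hΩb hΩreg i (fun j => hf (j + k))
      (fun j => hlam (j + k)) (fun j => hle (j + k)) hz hsum
    refine (hψ.continuousOn_inv _ (hP0 z hz)).tendsto.comp
      (tendsto_nhdsWithin_of_tendsto_nhds_of_eventually_within _ hcP ?_)
    filter_upwards [hΩo.mem_nhds hz] with y hy using hP0 y hy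
  refine ⟨⟨hF.isPSH hΩo ⟨a, ha, (EReal.bot_lt_zero.trans_le (hF0 a ha)).ne'⟩, ?_⟩,
    ⟨{z ∈ Ω | ∑' j, f j z = ⊤}, ⟨fun z hz => hz.1, _, (PosSH.tsum hf).preSH.isPSH hΩo ?_, ?_⟩,
      ?_⟩, ?_⟩
  · intro Ω' _ hb' hsub v hv hoff
    refine hv.preSH.le_of_le_off_compact_of_tsum hΩo hc hΩb hb'.isCompact_closure hsub hF hF0 hf
      hne hcontF (fun z hz => ?_) fun z hz => hoff z ⟨hz.1, fun h => hz.2 (subset_closure h)⟩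
    obtain ⟨V, hV, hVΩ, j, hj⟩ := hdep z hz
    exact ⟨V, hV, hVΩ, j, fun x hx y hy hxy => congrArg Ψinv (hj x hx y hy hxy)⟩
  · obtain ⟨z, hz, hz'⟩ := hne
    exact ⟨z, hz, by simpa using hz'⟩
  · intro z hz
    simp [hz.2]
  · exact fun z hz => (hcontF 0 z hz.1 fun h => hz.2 ⟨hz.1, h⟩).continuousWithinAt
  · intro ξ hξ
    have hξc := frontier_subset_closure hξ
    have : (𝓝[Ω] ξ).NeBot := mem_closure_iff_nhdsWithin_neBot.1 hξc
    have hlim := G.tendsto_perron hΩo hc hΩb hΩreg i hξ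
    rw [show lscReg Ω (fun ζ => Ψ (φ ζ)) ξ = Ψ (lscReg Ω φ ξ) from
      (hψ.tendsto_comp H hξc).liminf_eq] at hlim
    have hL := H.lscReg_nonneg hξc
    have := ((hψ.continuousOn_inv _ (hψ.nonneg hL)).tendsto.comp
      (tendsto_nhdsWithin_of_tendsto_nhds_of_eventually_within _ hlim
        (by filter_upwards [self_mem_nhdsWithin] with z hz using hP0 z hz)))
    rwa [hψ.inv _ hL] at this
end
end

section
/- Let 𝔹 = {(z, w) ∈ ℂ² : |z|² + |w|² < 1} be the unit ball and let φ(z, w) = −log|z|. Then for every function ψ: [−∞, +∞] → [0, +∞] with lim_{t→∞} ψ(t)/t = +∞, the composition ψ∘φ admits no plurisuperharmonic majorant on 𝔹 (indeed, any plurisubharmonic minorant of −ψ∘φ would have infinite Lelong number at the origin). Consequently, φ = −log|z| is not tame on 𝔹. -/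
open Complex Polynomial Filter Set Topology

noncomputable section

/-- The open unit ball in `ℂ²`. -/
def unitBall2 : Set (Fin 2 → ℂ) := { p | ‖p 0‖ ^ 2 + ‖p 1‖ ^ 2 < 1 }

theorem EReal.add_coe_le_coe_iff (x : EReal) (b c : ℝ) :
    x + (b : EReal) ≤ (c : EReal) ↔ x ≤ ((c - b : ℝ) : EReal) := by
  induction x with
  | bot => simp
  | top =>
    rw [EReal.top_add_coe]
    exact ⟨fun h => absurd (top_le_iff.mp h) (EReal.coe_ne_top _),
      fun h => absurd (top_le_iff.mp h) (EReal.coe_ne_top _)⟩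
  | coe x => norm_cast; constructor <;> intro h <;> linarith

theorem EReal.exists_real_ge {x : EReal} (hx : x ≠ ⊤) : ∃ c : ℝ, x ≤ (c : EReal) := by
  induction x with
  | bot => exact ⟨0, bot_le⟩
  | top => exact absurd rfl hx
  | coe x => exact ⟨x, le_rfl⟩

/-- Second order Taylor expansion of `log ‖c + t‖` in `t`. -/
theorem abs_log_norm_add_sub_taylor_le {c t : ℂ} (hc : c ≠ 0) (ht : ‖t‖ ≤ ‖c‖ / 2) :
    |Real.log ‖c + t‖ - (Real.log ‖c‖ + (t / c - (t / c) ^ 2 / 2).re)| ≤ ‖t‖ ^ 3 / ‖c‖ ^ 3 := by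
  have hc' : 0 < ‖c‖ := norm_pos_iff.mpr hc
  set s := t / c with hs
  have hsn : ‖s‖ = ‖t‖ / ‖c‖ := norm_div _ _
  have hs2 : ‖s‖ ≤ 1 / 2 := by
    rw [hsn, div_le_iff₀ hc']; linarith
  have h1 : 1 + s ≠ 0 := by
    intro h
    have : s = -1 := by linear_combination h
    rw [this] at hs2
    norm_num at hs2
  have hct : c + t = c * (1 + s) := by rw [hs]; field_simp
  have hlog : Real.log ‖c + t‖ = Real.log ‖c‖ + (Complex.log (1 + s)).re := by
    rw [hct, norm_mul, Real.log_mul hc'.ne' (norm_ne_zero_iff.mpr h1), Complex.log_re]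
  have key := Complex.norm_log_sub_logTaylor_le 2 (z := s) (by linarith)
  have hT : Complex.logTaylor (2 + 1) s = s - s ^ 2 / 2 := by
    simp [Complex.logTaylor_succ, Complex.logTaylor_zero]
    ring
  rw [hT] at key
  have hinv : (1 - ‖s‖)⁻¹ ≤ 2 := by
    rw [inv_le_comm₀ (by linarith) (by norm_num)]; linarith
  calc _ = |(Complex.log (1 + s) - (s - s ^ 2 / 2)).re| := by
        rw [hlog, Complex.sub_re (Complex.log (1 + s))]; congr 1; ring
    _ ≤ _ := Complex.abs_re_le_norm _
    _ ≤ _ := key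
    _ ≤ ‖s‖ ^ 3 := by
        have h3 : 0 ≤ ‖s‖ ^ 3 := by positivity
        norm_num
        nlinarith [mul_le_mul_of_nonneg_left hinv h3]
    _ = _ := by rw [hsn, div_pow]

/-- Maximum principle on an annulus: a function satisfying the sub-mean value inequality against
real parts of polynomials is dominated by `a + M log ‖·‖` as soon as it is so on the boundary. -/
theorem le_add_mul_log_norm_of_annulus {g : ℂ → EReal} {ρ R a M : ℝ} (hρ : 0 < ρ)
    (husc : UpperSemicontinuousOn g {ζ | ρ ≤ ‖ζ‖ ∧ ‖ζ‖ ≤ R})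
    (htop : ∀ ζ, ρ ≤ ‖ζ‖ → ‖ζ‖ ≤ R → g ζ ≠ ⊤)
    (hsub : ∀ c : ℂ, ∀ r : ℝ, 0 < r → ρ ≤ ‖c‖ - r → ‖c‖ + r ≤ R → ∀ p : Polynomial ℂ,
      (∀ t : ℂ, ‖t‖ = r → g (c + t) ≤ (((p.eval t).re : ℝ) : EReal)) →
      g c ≤ (((p.eval 0).re : ℝ) : EReal))
    (hin : ∀ ζ, ‖ζ‖ = ρ → g ζ ≤ ((a + M * Real.log ‖ζ‖ : ℝ) : EReal))
    (hout : ∀ ζ, ‖ζ‖ = R → g ζ ≤ ((a + M * Real.log ‖ζ‖ : ℝ) : EReal))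
    {ζ : ℂ} (h1 : ρ ≤ ‖ζ‖) (h2 : ‖ζ‖ ≤ R) :
    g ζ ≤ ((a + M * Real.log ‖ζ‖ : ℝ) : EReal) := by
  by_contra! hlt
  obtain ⟨b, hb1, hb2⟩ := EReal.lt_iff_exists_real_btwn.mp hlt
  rw [EReal.coe_lt_coe_iff] at hb1
  have hR : 0 < R := by linarith
  set A : Set ℂ := {ζ | ρ ≤ ‖ζ‖ ∧ ‖ζ‖ ≤ R} with hA
  obtain ⟨ε, hε, hεb⟩ : ∃ ε : ℝ, 0 < ε ∧ ε * R ^ 2 < b - (a + M * Real.log ‖ζ‖) := by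
    refine ⟨(b - (a + M * Real.log ‖ζ‖)) / (2 * R ^ 2), by
      have := sub_pos.mpr hb1; positivity, ?_⟩
    field_simp
    linarith
  have hAc : IsCompact A := by
    refine (isCompact_closedBall (0 : ℂ) R).of_isClosed_subset ?_ ?_
    · exact (isClosed_le continuous_const continuous_norm).inter
        (isClosed_le continuous_norm continuous_const)
    · intro z hz; simpa using hz.2
  let β : ℂ → ℝ := fun z => -M * Real.log ‖z‖ + ε * ‖z‖ ^ 2
  have hβ : ContinuousOn β A := by
    have : ∀ z ∈ A, ‖z‖ ≠ 0 := fun z hz => (lt_of_lt_of_le hρ hz.1).ne'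
    have hl : ContinuousOn (fun z : ℂ => Real.log ‖z‖) A := continuous_norm.continuousOn.log this
    exact (continuousOn_const.mul hl).add (by fun_prop)
  have hF : UpperSemicontinuousOn (fun z => g z + ((β z : ℝ) : EReal)) A := by
    refine husc.add' ?_ ?_
    · exact (continuous_coe_real_ereal.comp_continuousOn hβ).upperSemicontinuousOn
    · intro z hz
      exact EReal.continuousAt_add (Or.inr (EReal.coe_ne_bot _)) (Or.inr (EReal.coe_ne_top _))
  obtain ⟨c, hcA, hmax⟩ := hF.exists_isMaxOn (show A.Nonempty from ⟨ζ, h1, h2⟩) hAc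
  have hmax' : ∀ z ∈ A, g z + ((β z : ℝ) : EReal) ≤ g c + ((β c : ℝ) : EReal) := hmax
  have hbig : ¬ g c + ((β c : ℝ) : EReal) ≤ ((a + ε * R ^ 2 : ℝ) : EReal) := by
    intro h
    have := (hmax' ζ ⟨h1, h2⟩).trans h
    rw [EReal.add_coe_le_coe_iff] at this
    have h3 := hb2.trans_le this
    rw [EReal.coe_lt_coe_iff] at h3
    have : 0 ≤ ε * ‖ζ‖ ^ 2 := by positivity
    simp only [β] at h3
    linarith
  have hbdry : ∀ z : ℂ, z ∈ A → g z ≤ ((a + M * Real.log ‖z‖ : ℝ) : EReal) →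
      g z + ((β z : ℝ) : EReal) ≤ ((a + ε * R ^ 2 : ℝ) : EReal) := by
    intro z hz h
    rw [EReal.add_coe_le_coe_iff]
    refine h.trans (EReal.coe_le_coe_iff.mpr ?_)
    have : ‖z‖ ^ 2 ≤ R ^ 2 := pow_le_pow_left₀ (norm_nonneg _) hz.2 2
    have := mul_le_mul_of_nonneg_left this hε.le
    simp only [β]
    linarith
  have hc1 : ρ < ‖c‖ := lt_of_le_of_ne hcA.1 fun h => hbig (hbdry c hcA (hin c h.symm))
  have hc2 : ‖c‖ < R := lt_of_le_of_ne hcA.2 fun h => hbig (hbdry c hcA (hout c h))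
  have hc0 : 0 < ‖c‖ := by linarith
  obtain ⟨m, hm⟩ : ∃ m : ℝ, g c = ((m - β c : ℝ) : EReal) := by
    have ht := htop c hcA.1 hcA.2
    have hbt : g c ≠ ⊥ := by
      intro h; rw [h] at hbig; simp at hbig
    lift g c to ℝ using ⟨ht, hbt⟩ with y
    exact ⟨y + β c, by simp⟩
  have hgle : ∀ z ∈ A, g z ≤ ((m - β z : ℝ) : EReal) := by
    intro z hz
    have := hmax' z hz
    rw [hm, ← EReal.coe_add, sub_add_cancel, EReal.add_coe_le_coe_iff] at this
    exact this
  obtain ⟨r, hr, hr1, hr2, hr3, hr4⟩ : ∃ r : ℝ, 0 < r ∧ r ≤ ‖c‖ - ρ ∧ r ≤ R - ‖c‖ ∧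
      r ≤ ‖c‖ / 2 ∧ |M| / ‖c‖ ^ 3 * r < ε := by
    set K := |M| / ‖c‖ ^ 3 with hK
    have hK0 : 0 ≤ K := by positivity
    refine ⟨min (min (‖c‖ - ρ) (R - ‖c‖)) (min (‖c‖ / 2) (ε / (K + 1))), ?_, ?_, ?_, ?_, ?_⟩
    · have h1 := sub_pos.mpr hc1
      have h2 := sub_pos.mpr hc2
      positivity
    · exact (min_le_left _ _).trans (min_le_left _ _)
    · exact (min_le_left _ _).trans (min_le_right _ _)
    · exact (min_le_right _ _).trans (min_le_left _ _)
    · calc K * _ ≤ K * (ε / (K + 1)) :=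
          mul_le_mul_of_nonneg_left ((min_le_right _ _).trans (min_le_right _ _)) hK0
        _ < ε := by
          rw [mul_div_assoc', div_lt_iff₀ (by linarith)]
          nlinarith
  have hcne : c ≠ 0 := norm_pos_iff.mp hc0
  let κ : ℝ := m + M * Real.log ‖c‖ + |M| * (r ^ 3 / ‖c‖ ^ 3) - ε * (‖c‖ ^ 2 + r ^ 2)
  let p : Polynomial ℂ := C (κ : ℂ) +
    C (M : ℂ) * (C c⁻¹ * X - C ((c⁻¹) ^ 2 / 2) * X ^ 2) -
    C (2 * (ε : ℂ) * (starRingEnd ℂ) c) * X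
  have hp : ∀ t : ℂ, (p.eval t).re =
      κ + M * (t / c - (t / c) ^ 2 / 2).re - 2 * ε * (c.re * t.re + c.im * t.im) := by
    intro t
    have : p.eval t = (κ : ℂ) + (M : ℂ) * (t / c - (t / c) ^ 2 / 2) -
        ((2 * ε : ℝ) : ℂ) * ((starRingEnd ℂ) c * t) := by
      simp [p]; ring
    rw [this, Complex.sub_re, Complex.add_re, Complex.re_ofReal_mul, Complex.re_ofReal_mul,
      Complex.ofReal_re, Complex.mul_re, Complex.conj_re, Complex.conj_im]
    ring
  have hcirc : ∀ t : ℂ, ‖t‖ = r → g (c + t) ≤ (((p.eval t).re : ℝ) : EReal) := by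
    intro t ht
    have hmem : c + t ∈ A := by
      constructor
      · have := norm_sub_le (c + t) t
        rw [add_sub_cancel_right] at this
        linarith
      · have := norm_add_le c t
        linarith
    refine (hgle _ hmem).trans (EReal.coe_le_coe_iff.mpr ?_)
    rw [hp]
    have hT := abs_log_norm_add_sub_taylor_le hcne (ht.le.trans hr3)
    rw [ht] at hT
    have hT2 : M * (Real.log ‖c + t‖ - (Real.log ‖c‖ + (t / c - (t / c) ^ 2 / 2).re)) ≤
        |M| * (r ^ 3 / ‖c‖ ^ 3) := by
      refine (le_abs_self _).trans ?_
      rw [abs_mul]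
      exact mul_le_mul_of_nonneg_left hT (abs_nonneg _)
    have hsq : ‖c + t‖ ^ 2 = ‖c‖ ^ 2 + r ^ 2 + 2 * (c.re * t.re + c.im * t.im) := by
      rw [← ht, Complex.sq_norm, Complex.sq_norm, Complex.sq_norm, Complex.normSq_apply,
        Complex.normSq_apply, Complex.normSq_apply, Complex.add_re, Complex.add_im]
      ring
    simp only [β, κ]
    rw [hsq]
    linarith
  have hfin := hsub c r hr (by linarith) (by linarith) p hcirc
  rw [hm, EReal.coe_le_coe_iff, hp] at hfin
  simp only [β, κ] at hfin
  have hlt2 : |M| * (r ^ 3 / ‖c‖ ^ 3) < ε * r ^ 2 := by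
    have : |M| * (r ^ 3 / ‖c‖ ^ 3) = |M| / ‖c‖ ^ 3 * r * r ^ 2 := by ring
    rw [this]
    exact mul_lt_mul_of_pos_right hr4 (by positivity)
  simp at hfin
  linarith

theorem continuous_slice (w : ℂ) : Continuous fun ζ : ℂ => (![ζ, w] : Fin 2 → ℂ) := by
  refine continuous_pi fun i => ?_
  fin_cases i
  · exact continuous_id
  · exact continuous_const

theorem slice_mem_unitBall2 {R : ℝ} {w ζ : ℂ} (hRw : R ^ 2 + ‖w‖ ^ 2 < 1) (h : ‖ζ‖ ≤ R) :
    ![ζ, w] ∈ unitBall2 := by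
  have := pow_le_pow_left₀ (norm_nonneg ζ) h 2
  change ‖ζ‖ ^ 2 + ‖w‖ ^ 2 < 1
  linarith

theorem slice_add_smul (c w t : ℂ) :
    (![c, w] : Fin 2 → ℂ) + t • ![1, 0] = ![c + t, w] := by
  ext i; fin_cases i <;> simp

/-- The sub-mean value inequality of a plurisubharmonic function along horizontal slices. -/
theorem IsPSH.slice_le {u : (Fin 2 → ℂ) → EReal} (hu : IsPSH unitBall2 u) {R r : ℝ} {c w : ℂ}
    (hRw : R ^ 2 + ‖w‖ ^ 2 < 1) (hr : 0 < r) (hc : ‖c‖ + r ≤ R) (p : Polynomial ℂ)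
    (h : ∀ t : ℂ, ‖t‖ = r → u ![c + t, w] ≤ (((p.eval t).re : ℝ) : EReal)) :
    u ![c, w] ≤ (((p.eval 0).re : ℝ) : EReal) := by
  have key := hu.2.2.2 ![c, w] (slice_mem_unitBall2 hRw (by linarith)) ![1, 0] r hr
    (fun t ht => by
      rw [slice_add_smul]
      exact slice_mem_unitBall2 hRw ((norm_add_le _ _).trans (by linarith)))
    p (fun t ht => by rw [slice_add_smul]; exact h t ht) 0 (by simpa using hr.le)
  rwa [slice_add_smul, add_zero] at key

/-- The annulus maximum principle for slices of plurisubharmonic functions. -/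
theorem IsPSH.slice_le_add_mul_log {u : (Fin 2 → ℂ) → EReal} (hu : IsPSH unitBall2 u)
    {ρ R a M : ℝ} {w ζ : ℂ} (hρ : 0 < ρ) (hRw : R ^ 2 + ‖w‖ ^ 2 < 1)
    (hin : ∀ ζ : ℂ, ‖ζ‖ = ρ → u ![ζ, w] ≤ ((a + M * Real.log ‖ζ‖ : ℝ) : EReal))
    (hout : ∀ ζ : ℂ, ‖ζ‖ = R → u ![ζ, w] ≤ ((a + M * Real.log ‖ζ‖ : ℝ) : EReal))
    (h1 : ρ ≤ ‖ζ‖) (h2 : ‖ζ‖ ≤ R) :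
    u ![ζ, w] ≤ ((a + M * Real.log ‖ζ‖ : ℝ) : EReal) := by
  refine le_add_mul_log_norm_of_annulus (g := fun ζ => u ![ζ, w]) hρ ?_ ?_ ?_ hin hout h1 h2
  · exact hu.1.comp (continuous_slice w).continuousOn
      fun z hz => slice_mem_unitBall2 hRw hz.2
  · exact fun z _ hz => hu.2.1 _ (slice_mem_unitBall2 hRw hz)
  · exact fun c r hr _ hc p h => hu.slice_le hRw hr hc p h

theorem eq_slice (p : Fin 2 → ℂ) : p = ![p 0, p 1] := by
  ext i; fin_cases i <;> rfl

/-- A plurisubharmonic function bounded by `log |z|` near `{z = 0}` is `-∞` on `{z = 0}`. -/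
theorem IsPSH.eq_bot_of_le_log {u : (Fin 2 → ℂ) → EReal} (hu : IsPSH unitBall2 u) {δ : ℝ}
    (hδ : 0 < δ)
    (h : ∀ p ∈ unitBall2, p 0 ≠ 0 → ‖p 0‖ ≤ δ → u p ≤ ((Real.log ‖p 0‖ : ℝ) : EReal))
    {w : ℂ} (hw : ‖w‖ < 1) : u ![0, w] = ⊥ := by
  obtain ⟨R, hR, hRw⟩ : ∃ R : ℝ, 0 < R ∧ R ^ 2 + ‖w‖ ^ 2 < 1 :=
    ⟨(1 - ‖w‖) / 2, by linarith, by nlinarith [norm_nonneg w]⟩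
  rw [EReal.eq_bot_iff_forall_lt]
  intro y
  obtain ⟨r, hr, hrR, hrδ, hry⟩ : ∃ r : ℝ, 0 < r ∧ r ≤ R ∧ r ≤ δ ∧ Real.log r < y := by
    refine ⟨min (min R δ) (Real.exp (y - 1)), by positivity,
      (min_le_left _ _).trans (min_le_left _ _), (min_le_left _ _).trans (min_le_right _ _), ?_⟩
    calc _ ≤ Real.log (Real.exp (y - 1)) := Real.log_le_log (by positivity) (min_le_right _ _)
      _ < y := by rw [Real.log_exp]; linarith
  have := hu.slice_le (c := 0) hRw hr (by simpa using hrR) (C (Real.log r : ℂ)) (fun t ht => by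
    have ht0 : t ≠ 0 := by rw [← norm_pos_iff, ht]; exact hr
    have := h ![0 + t, w] (slice_mem_unitBall2 hRw (by simpa [ht] using hrR))
      (by simpa using ht0) (by simpa [ht] using hrδ)
    simpa [ht] using this)
  refine this.trans_lt (EReal.coe_lt_coe_iff.mpr ?_)
  simpa using hry

/-- A plurisubharmonic function cannot have infinite order along `{z = 0}`. -/
theorem IsPSH.not_forall_le_mul_log {u : (Fin 2 → ℂ) → EReal} (hu : IsPSH unitBall2 u)
    (h : ∀ M : ℝ, 0 < M → ∃ δ : ℝ, 0 < δ ∧ ∀ p ∈ unitBall2, p 0 ≠ 0 → ‖p 0‖ ≤ δ →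
      u p ≤ ((M * Real.log ‖p 0‖ : ℝ) : EReal)) : False := by
  obtain ⟨q, hq, hqbot⟩ := hu.2.2.1
  apply hqbot
  have hq' : ‖q 0‖ ^ 2 + ‖q 1‖ ^ 2 < 1 := hq
  rw [eq_slice q]
  set w := q 1
  set z := q 0
  by_cases hz : z = 0
  · obtain ⟨δ, hδ, hle⟩ := h 1 one_pos
    rw [hz]
    refine hu.eq_bot_of_le_log hδ (by simpa using hle) ?_
    rw [hz] at hq'
    nlinarith [norm_nonneg w]
  have hz0 : 0 < ‖z‖ := norm_pos_iff.mpr hz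
  obtain ⟨R, hzR, hRw⟩ : ∃ R : ℝ, ‖z‖ < R ∧ R ^ 2 + ‖w‖ ^ 2 < 1 := by
    have h1 : ‖z‖ < √(1 - ‖w‖ ^ 2) := Real.lt_sqrt_of_sq_lt (by linarith)
    obtain ⟨R, hR1, hR2⟩ := exists_between h1
    refine ⟨R, hR1, ?_⟩
    have := (Real.lt_sqrt (by linarith)).mp hR2
    linarith
  have hR : 0 < R := hz0.trans hzR
  obtain ⟨K, hK⟩ : ∃ K : ℝ, ∀ ζ : ℂ, ‖ζ‖ = R → u ![ζ, w] ≤ (K : EReal) := by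
    have husc : UpperSemicontinuousOn (fun ζ : ℂ => u ![ζ, w]) (Metric.sphere 0 R) :=
      hu.1.comp (continuous_slice w).continuousOn
        fun ζ hζ => slice_mem_unitBall2 hRw (by simpa using (mem_sphere_zero_iff_norm.mp hζ).le)
    obtain ⟨c, hc, hmax⟩ := husc.exists_isMaxOn
      (NormedSpace.sphere_nonempty.mpr hR.le) (isCompact_sphere 0 R)
    obtain ⟨K, hK⟩ := EReal.exists_real_ge
      (hu.2.1 ![c, w] (slice_mem_unitBall2 hRw (mem_sphere_zero_iff_norm.mp hc).le))
    exact ⟨K, fun ζ hζ => le_trans (hmax (mem_sphere_zero_iff_norm.mpr hζ)) hK⟩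
  have hbound : ∀ M : ℝ, 0 < M →
      u ![z, w] ≤ ((K - M * Real.log R + M * Real.log ‖z‖ : ℝ) : EReal) := by
    intro M hM
    obtain ⟨δ, hδ, hle⟩ := h (M + 1) (by linarith)
    set ρ := min (min δ ‖z‖) (Real.exp (K - M * Real.log R)) with hρdef
    have hρ : 0 < ρ := by positivity
    have hρδ : ρ ≤ δ := (min_le_left _ _).trans (min_le_left _ _)
    have hρz : ρ ≤ ‖z‖ := (min_le_left _ _).trans (min_le_right _ _)
    have hρl : Real.log ρ ≤ K - M * Real.log R := by
      rw [Real.log_le_iff_le_exp hρ]; exact min_le_right _ _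
    refine hu.slice_le_add_mul_log hρ hRw (fun ζ hζ => ?_) (fun ζ hζ => ?_) hρz hzR.le
    · have := hle ![ζ, w] (slice_mem_unitBall2 hRw (by linarith))
        (by simpa [← norm_pos_iff, hζ] using hρ) (by simpa [hζ] using hρδ)
      refine this.trans (EReal.coe_le_coe_iff.mpr ?_)
      simp only [Matrix.cons_val_zero, hζ]
      linarith
    · refine (hK ζ hζ).trans (EReal.coe_le_coe_iff.mpr ?_)
      rw [hζ]; linarith
  rw [EReal.eq_bot_iff_forall_lt]
  intro y
  have hlog : Real.log ‖z‖ < Real.log R := Real.log_lt_log hz0 hzR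
  set d := Real.log R - Real.log ‖z‖ with hd
  have hd0 : 0 < d := by linarith
  refine (hbound ((|K - y| + 1) / d) (by positivity)).trans_lt (EReal.coe_lt_coe_iff.mpr ?_)
  have h1 : (|K - y| + 1) / d * d = |K - y| + 1 := by field_simp
  have h2 := le_abs_self (K - y)
  nlinarith

/-- If `u ≤ -ψ(-log |z|)` with `ψ` superlinear, then `u ≤ M log |z|` near `{z = 0}` for all `M`. -/
theorem exists_le_mul_log_of_superlinear {ψ : EReal → EReal}
    (hψ : Tendsto (fun t : ℝ => ψ (t : EReal) / (t : EReal)) atTop (𝓝 (⊤ : EReal))) {M : ℝ} :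
    ∃ δ : ℝ, 0 < δ ∧ ∀ x : ℝ, 0 < x → x ≤ δ →
      -(ψ ((-Real.log x : ℝ) : EReal)) ≤ ((M * Real.log x : ℝ) : EReal) := by
  have h := hψ.eventually (lt_mem_nhds (EReal.coe_lt_top M))
  obtain ⟨T, hT⟩ := Filter.eventually_atTop.mp h
  refine ⟨Real.exp (-(max T 1)), Real.exp_pos _, fun x hx hxδ => ?_⟩
  have hlog : Real.log x ≤ -(max T 1) := (Real.log_le_iff_le_exp hx).mpr hxδ
  have h1 := le_max_left T 1
  have h2 := le_max_right T 1
  have := (hT (-Real.log x) (by linarith)).le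
  rw [EReal.le_div_iff_mul_le (EReal.coe_pos.mpr (by linarith)) (EReal.coe_ne_top _)] at this
  rw [EReal.neg_le, ← EReal.coe_neg]
  refine le_trans (le_of_eq ?_) this
  rw [← EReal.coe_mul]
  congr 1
  ring

/-- Lower bound, uniform in `λ`, for the plurisuperharmonic majorants of `(-log |z| - λ)⁺`. -/
theorem IsPSH.le_half_log {u : (Fin 2 → ℂ) → EReal} (hu : IsPSH unitBall2 u) {lam : ℝ}
    (h0 : ∀ p ∈ unitBall2, u p ≤ 0)
    (hlam : ∀ p ∈ unitBall2, p 0 ≠ 0 → u p ≤ ((Real.log ‖p 0‖ + lam : ℝ) : EReal))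
    {z w : ℂ} (hz : z ≠ 0) (hzR : ‖z‖ ≤ 1 / 2) (hw : ‖w‖ ≤ 1 / 2) :
    u ![z, w] ≤ ((1 / 2 * (Real.log ‖z‖ - Real.log (1 / 2)) : ℝ) : EReal) := by
  have hRw : (1 / 2 : ℝ) ^ 2 + ‖w‖ ^ 2 < 1 := by nlinarith [norm_nonneg w]
  have hz0 : 0 < ‖z‖ := norm_pos_iff.mpr hz
  set ρ := min ‖z‖ (Real.exp (-(2 * lam) - Real.log (1 / 2))) with hρdef
  have hρ : 0 < ρ := by positivity
  have hρl : Real.log ρ ≤ -(2 * lam) - Real.log (1 / 2) := by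
    rw [Real.log_le_iff_le_exp hρ]; exact min_le_right _ _
  have hρz : ρ ≤ ‖z‖ := min_le_left _ _
  have := hu.slice_le_add_mul_log (a := -(1 / 2 * Real.log (1 / 2))) (M := 1 / 2) hρ hRw
    (fun ζ hζ => ?_) (fun ζ hζ => ?_) hρz hzR
  · refine this.trans (EReal.coe_le_coe_iff.mpr (by linarith))
  · have := hlam ![ζ, w] (slice_mem_unitBall2 hRw (by linarith))
      (by simpa [← norm_pos_iff, hζ] using hρ)
    refine this.trans (EReal.coe_le_coe_iff.mpr ?_)
    simp only [Matrix.cons_val_zero, hζ]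
    linarith
  · refine (h0 _ (slice_mem_unitBall2 hRw hζ.le)).trans (EReal.coe_nonneg.mpr ?_)
    rw [hζ]; linarith

theorem unitBall2_norm_lt_one {p : Fin 2 → ℂ} (hp : p ∈ unitBall2) : ‖p 0‖ < 1 ∧ ‖p 1‖ < 1 := by
  have hp' : ‖p 0‖ ^ 2 + ‖p 1‖ ^ 2 < 1 := hp
  constructor <;> nlinarith [norm_nonneg (p 0), norm_nonneg (p 1)]

/-- Example 4.10, non-tameness: on the unit ball `𝔹 ⊆ ℂ²`, let
`φ(z, w) = −log|z|` (equal to `+∞` when `z = 0`). For every `ψ : [−∞, +∞] → [0, +∞]` with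
`lim_{t→∞} ψ(t)/t = +∞`, the composition `ψ∘φ` admits no plurisuperharmonic majorant on
`𝔹`; indeed, any plurisubharmonic minorant of `−ψ∘φ` would have infinite Lelong number at
the origin. Consequently, `φ = −log|z|` is not tame on `𝔹`. -/
theorem statement19 (φ : (Fin 2 → ℂ) → EReal)
    (hφ : ∀ p : Fin 2 → ℂ,
      φ p = if p 0 = 0 then (⊤ : EReal) else ((-Real.log ‖p 0‖ : ℝ) : EReal)) :
    (∀ ψ : EReal → EReal, (∀ t, 0 ≤ ψ t) →
      Tendsto (fun t : ℝ => ψ (t : EReal) / (t : EReal)) atTop (nhds (⊤ : EReal)) →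
      (∀ u, IsPSH unitBall2 u → (∀ p ∈ unitBall2, u p ≤ -(ψ (φ p))) →
        liminf (fun p : Fin 2 → ℂ =>
            (2 : EReal) * u p / ((Real.log (‖p 0‖ ^ 2 + ‖p 1‖ ^ 2) : ℝ) : EReal))
          (nhdsWithin 0 (unitBall2 \ {0})) = (⊤ : EReal)) ∧
      ¬ ∃ v, IsPSupH unitBall2 v ∧ ∀ p ∈ unitBall2, ψ (φ p) ≤ v p) ∧
    ¬ Tame unitBall2 φ := by
  have hle : ∀ ψ : EReal → EReal,
      Tendsto (fun t : ℝ => ψ (t : EReal) / (t : EReal)) atTop (nhds (⊤ : EReal)) →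
      ∀ u : (Fin 2 → ℂ) → EReal, (∀ p ∈ unitBall2, u p ≤ -(ψ (φ p))) →
      ∀ M : ℝ, ∃ δ : ℝ, 0 < δ ∧ ∀ p ∈ unitBall2, p 0 ≠ 0 → ‖p 0‖ ≤ δ →
        u p ≤ ((M * Real.log ‖p 0‖ : ℝ) : EReal) := by
    intro ψ hψ u hu M
    obtain ⟨δ, hδ, h⟩ := exists_le_mul_log_of_superlinear hψ (M := M)
    refine ⟨δ, hδ, fun p hp hp0 hpδ => (hu p hp).trans ?_⟩
    rw [hφ p, if_neg hp0]
    exact h _ (norm_pos_iff.mpr hp0) hpδ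
  refine ⟨fun ψ _ hψ => ⟨fun u hu hmin => ?_, ?_⟩, fun hT => ?_⟩
  · rw [EReal.eq_top_iff_forall_lt]
    intro y
    obtain ⟨δ, hδ, hM⟩ := hle ψ hψ u hmin (|y| + 1)
    obtain ⟨δ', hδ', hM'⟩ := hle ψ hψ u hmin 1
    have hev : ∀ᶠ p : Fin 2 → ℂ in 𝓝[unitBall2 \ {0}] 0, ‖p 0‖ < δ := by
      have hc : Continuous fun p : Fin 2 → ℂ => ‖p 0‖ := by fun_prop
      exact nhdsWithin_le_nhds (hc.tendsto' 0 0 (by simp) |>.eventually (gt_mem_nhds hδ))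
    refine lt_of_lt_of_le (EReal.coe_lt_coe_iff.mpr
      (show y < |y| + 1 by linarith [le_abs_self y])) ?_
    refine le_liminf_of_le (by isBoundedDefault) ?_
    filter_upwards [hev, self_mem_nhdsWithin] with p hpδ hp
    have hpB : ‖p 0‖ ^ 2 + ‖p 1‖ ^ 2 < 1 := hp.1
    have hpos : 0 < ‖p 0‖ ^ 2 + ‖p 1‖ ^ 2 := by
      by_cases h0 : p 0 = 0
      · have h1 : p 1 ≠ 0 := by
          intro h1
          apply hp.2
          ext i; fin_cases i
          · exact h0
          · exact h1
        have := norm_pos_iff.mpr h1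
        positivity
      · have := norm_pos_iff.mpr h0
        positivity
    set L := Real.log (‖p 0‖ ^ 2 + ‖p 1‖ ^ 2) with hL
    have hLneg : L < 0 := Real.log_neg hpos hpB
    by_cases h0 : p 0 = 0
    · have hbot : u p = ⊥ := by
        rw [eq_slice p, h0]
        exact hu.eq_bot_of_le_log hδ' (by simpa using hM') (unitBall2_norm_lt_one hp.1).2
      rw [hbot, EReal.mul_bot_of_pos (by norm_num),
        EReal.bot_div_of_neg_ne_bot (EReal.coe_neg'.mpr hLneg) (EReal.coe_ne_bot _)]
      exact le_top
    · have hu1 := hM p hp.1 h0 hpδ.le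
      have hn0 := norm_pos_iff.mpr h0
      have hlog : 2 * Real.log ‖p 0‖ ≤ L := by
        have : Real.log (‖p 0‖ ^ 2) ≤ L :=
          Real.log_le_log (by positivity) (by nlinarith [norm_nonneg (p 1)])
        rwa [Real.log_pow] at this
      have htwo : (2 : EReal) = ((2 : ℝ) : EReal) := rfl
      have hneg : ((|y| + 1 : ℝ) : EReal) ≤
          (2 : EReal) * (((|y| + 1) * Real.log ‖p 0‖ : ℝ) : EReal) / ((L : ℝ) : EReal) := by
        rw [htwo, ← EReal.coe_mul, ← EReal.coe_div, EReal.coe_le_coe_iff,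
          le_div_iff_of_neg hLneg]
        have : 0 ≤ |y| + 1 := by positivity
        nlinarith
      refine hneg.trans (EReal.div_le_div_right_of_nonpos (EReal.coe_nonpos.mpr hLneg.le) ?_)
      exact mul_le_mul_of_nonneg_left hu1 (by norm_num)
  · rintro ⟨v, hv, hvφ⟩
    exact hv.not_forall_le_mul_log fun M _ =>
      hle ψ hψ (fun z => -(v z)) (fun p hp => EReal.neg_le_neg_iff.mpr (hvφ p hp)) M
  · set U : Set (Fin 2 → ℂ) := {p | p 0 ≠ 0 ∧ ‖p 0‖ < 1 / 3 ∧ ‖p 1‖ < 1 / 2} with hU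
    have hUo : IsOpen U := by
      have h0 : Continuous fun p : Fin 2 → ℂ => p 0 := continuous_apply 0
      have h1 : Continuous fun p : Fin 2 → ℂ => p 1 := continuous_apply 1
      exact (isOpen_ne_fun h0 continuous_const).inter
        ((isOpen_lt h0.norm continuous_const).inter (isOpen_lt h1.norm continuous_const))
    set k : ℝ := 1 / 2 * (Real.log (1 / 2) - Real.log (1 / 3)) with hk
    have hkpos : 0 < k := by
      have : Real.log (1 / 3) < Real.log (1 / 2) := Real.log_lt_log (by norm_num) (by norm_num)
      rw [hk]; linarith
    have hRop : ∀ lam : ℝ, ∀ p ∈ U, (k : EReal) ≤ Rop unitBall2 φ lam p := by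
      rintro lam p ⟨hp0, hp1, hp2⟩
      refine le_sInf ?_
      rintro _ ⟨v, hv, hmaj, rfl⟩
      have key := IsPSH.le_half_log (lam := lam) hv (fun q hq => ?_) (fun q hq hq0 => ?_)
        hp0 (by linarith) hp2.le
      · rw [← eq_slice p, EReal.neg_le, ← EReal.coe_neg] at key
        refine le_trans (EReal.coe_le_coe_iff.mpr ?_) key
        have := Real.log_le_log (norm_pos_iff.mpr hp0) hp1.le
        rw [hk]; linarith
      · have := (le_max_right _ _).trans (hmaj q hq)
        rwa [EReal.neg_le, neg_zero]
      · have := (le_max_left _ _).trans (hmaj q hq)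
        rw [hφ q, if_neg hq0, ← EReal.coe_sub] at this
        rw [EReal.neg_le, ← EReal.coe_neg]
        refine le_trans (EReal.coe_le_coe_iff.mpr (by linarith)) this
    have hlsc : ∀ f : (Fin 2 → ℂ) → EReal, (∀ p ∈ U, (k : EReal) ≤ f p) →
        ∀ p ∈ U, (k : EReal) ≤ lscReg unitBall2 f p := by
      intro f hf p hp
      refine le_liminf_of_le (by isBoundedDefault) ?_
      filter_upwards [nhdsWithin_le_nhds (hUo.mem_nhds hp)] with q hq using hf q hq
    have hp : (![1 / 4, 0] : Fin 2 → ℂ) ∈ U := by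
      refine ⟨?_, ?_, ?_⟩ <;> norm_num
    have hS : (k : EReal) ≤ Sop unitBall2 φ ![1 / 4, 0] :=
      hlsc _ (fun p hp => le_iInf₂ fun lam _ => hlsc _ (hRop lam) p hp) _ hp
    have hz := hT ![1 / 4, 0] (slice_mem_unitBall2 (R := 1 / 2) (by norm_num) (by norm_num))
    have hz' : (k : EReal) ≤ 0 := hz ▸ hS
    exact absurd (EReal.coe_nonpos.mp hz') (not_le.mpr hkpos)
end
end
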